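/- arXiv:1107.2515 — 8 statements merged into one kernel-verified Lean document; each statement's English description precedes it below -/
import Mathlib

section
/- Let ν ∈ (0,1) and λ > 0. For every t > 0, (1/t^ν) ∫_0^∞ e^{−λz} · W_{−ν,1−ν}(−z/t^ν) dz = E_{ν,1}(−λ t^ν); that is, the Laplace-type integral of the Wright density equals the Mittag-Leffler function, so the crossing probability ψ_ν(t) = Pr{T_ν(t) < U} of an exponential boundary by the process with Wright transition density solves the fractional relaxation equation of order ν. -/
open Real MeasureTheory Set

/-- Mittag-Leffler function `E_{a,b}(z) = Σ z^r / Γ(a r + b)`. -/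
noncomputable def mittagLeffler (a b z : ℝ) : ℝ :=
  ∑' r : ℕ, z ^ r / Real.Gamma (a * r + b)

/-- Wright function `W_{a,b}(x) = Σ x^j / (j! Γ(a j + b))`. -/
noncomputable def wright (a b x : ℝ) : ℝ :=
  ∑' j : ℕ, x ^ j / ((Nat.factorial j : ℝ) * Real.Gamma (a * j + b))

/-- Generalized Mittag-Leffler function `E^γ_{a,b}(z) = Σ (γ)_j z^j / (j! Γ(a j + b))`. -/
noncomputable def gml (a b γ z : ℝ) : ℝ :=
  ∑' j : ℕ, (∏ i ∈ Finset.range j, (γ + i)) * z ^ j /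
    ((Nat.factorial j : ℝ) * Real.Gamma (a * j + b))

/-- Caputo fractional derivative of order `ν`. -/
noncomputable def caputo (ν : ℝ) (f : ℝ → ℝ) (t : ℝ) : ℝ :=
  (1 / Real.Gamma (1 - ν)) * ∫ s in (0:ℝ)..t, (t - s) ^ (-ν) * deriv f s

open Filter Topology Asymptotics

theorem hasSum_integral_exp_series {Ω : Type*} [MeasurableSpace Ω] {m : Measure Ω}
    {φ p : Ω → ℂ} (hφ : AEStronglyMeasurable φ m) (hp : AEStronglyMeasurable p m)
    (hint : ∀ k : ℝ, 0 ≤ k → Integrable (fun ω => ‖φ ω‖ * Real.exp (k * ‖p ω‖)) m) (x : ℝ) :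
    HasSum (fun j : ℕ => ((-x : ℝ) : ℂ) ^ j / (j.factorial : ℂ) * ∫ ω, φ ω * p ω ^ (j + 1) ∂m)
      (∫ ω, φ ω * p ω * Complex.exp (-x * p ω) ∂m) := by
  simp_rw [← integral_const_mul]
  refine hasSum_integral_of_dominated_convergence
    (fun j ω => ‖φ ω‖ * ‖p ω‖ * ((|x| * ‖p ω‖) ^ j / (j.factorial : ℝ))) ?_ ?_ ?_ ?_ ?_
  · intro j
    exact (hφ.mul (hp.pow _)).const_mul _
  · intro j
    refine .of_forall fun ω => le_of_eq ?_
    simp [pow_succ, mul_pow]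
    ring
  · refine .of_forall fun ω => ?_
    exact (Real.summable_pow_div_factorial _).mul_left _
  · have h : ∀ ω, ∑' j : ℕ, ‖φ ω‖ * ‖p ω‖ * ((|x| * ‖p ω‖) ^ j / (j.factorial : ℝ))
        = ‖φ ω‖ * ‖p ω‖ * Real.exp (|x| * ‖p ω‖) := by
      intro ω
      rw [tsum_mul_left, Real.exp_eq_exp_ℝ, NormedSpace.exp_eq_tsum_div]
    simp_rw [h]
    refine (hint (|x| + 1) (by positivity)).mono' ?_ (.of_forall fun ω => ?_)
    · exact (hφ.norm.mul hp.norm).mul (Real.continuous_exp.comp_aestronglyMeasurable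
        (hp.norm.const_mul _))
    · rw [Real.norm_of_nonneg (by positivity), add_mul, Real.exp_add, one_mul, mul_assoc]
      have : ‖p ω‖ ≤ Real.exp ‖p ω‖ := by linarith [Real.add_one_le_exp ‖p ω‖]
      rw [mul_comm (Real.exp _) (Real.exp _)]
      gcongr
  · refine .of_forall fun ω => ?_
    have h := (NormedSpace.expSeries_div_hasSum_exp (𝔸 := ℂ) (-x * p ω)).mul_left (φ ω * p ω)
    rw [← Complex.exp_eq_exp_ℂ] at h
    refine h.congr_fun fun j => ?_
    push_cast
    ring

theorem integral_exp_mul_integral {Ω : Type*} [MeasurableSpace Ω] {m : Measure Ω} [SFinite m]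
    {φ p : Ω → ℂ} (hφ : AEStronglyMeasurable φ m) (hp : AEStronglyMeasurable p m)
    (hint : ∀ k : ℝ, 0 ≤ k → Integrable (fun ω => ‖φ ω‖ * Real.exp (k * ‖p ω‖)) m)
    (hre : ∀ ω, 0 ≤ (p ω).re) {μ : ℝ} (hμ : 0 < μ) :
    ∫ x in Ioi (0 : ℝ), Complex.exp (-μ * x) * ∫ ω, φ ω * p ω * Complex.exp (-x * p ω) ∂m
      = ∫ ω, φ ω * p ω / (μ + p ω) ∂m := by
  simp_rw [← integral_const_mul]
  have hφp : Integrable (fun ω => φ ω * p ω) m := by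
    refine (hint 1 zero_le_one).mono' (hφ.mul hp) (.of_forall fun ω => ?_)
    rw [norm_mul, one_mul]
    have : ‖p ω‖ ≤ Real.exp ‖p ω‖ := by linarith [Real.add_one_le_exp ‖p ω‖]
    gcongr
  have hexp : Integrable (fun x : ℝ => Real.exp (-μ * x)) (volume.restrict (Ioi 0)) :=
    exp_neg_integrableOn_Ioi 0 hμ
  rw [integral_integral_swap]
  · refine integral_congr_ae (.of_forall fun ω => ?_)
    have h : ∀ x : ℝ, Complex.exp (-μ * x) * (φ ω * p ω * Complex.exp (-x * p ω))
        = φ ω * p ω * Complex.exp (-(μ + p ω) * x) := by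
      intro x
      rw [mul_left_comm, ← Complex.exp_add]
      ring_nf
    have hr := hre ω
    have := integral_exp_mul_complex_Ioi (a := -(μ + p ω)) (by simp; linarith) 0
    simp only [h, integral_const_mul, this]
    rw [Complex.ofReal_zero, mul_zero, Complex.exp_zero, neg_div_neg_eq, mul_one_div]
  · refine (hexp.mul_prod hφp.norm).mono' ?_ ?_
    · refine AEStronglyMeasurable.mul (by fun_prop) (AEStronglyMeasurable.mul ?_ ?_)
      · exact hφp.aestronglyMeasurable.comp_snd
      · exact Complex.continuous_exp.comp_aestronglyMeasurable
          (AEStronglyMeasurable.mul (by fun_prop) hp.comp_snd)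
    · filter_upwards [Measure.quasiMeasurePreserving_fst.ae
        (ae_restrict_mem (μ := volume) (measurableSet_Ioi (a := (0 : ℝ))))] with z hz
      have hz0 : 0 < z.1 := hz
      have h1 : 0 ≤ z.1 * (p z.2).re := mul_nonneg hz0.le (hre _)
      have h2 : ‖Complex.exp (-z.1 * p z.2)‖ ≤ 1 := by
        rw [Complex.norm_exp, Real.exp_le_one_iff]
        simpa using h1
      have h3 : ‖Complex.exp (-μ * z.1)‖ = Real.exp (-μ * z.1) := by
        rw [Complex.norm_exp]
        simp
      change ‖Complex.exp (-μ * z.1) * (φ z.2 * p z.2 * Complex.exp (-z.1 * p z.2))‖ ≤ _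
      rw [norm_mul, norm_mul (φ z.2 * p z.2), h3]
      gcongr
      exact mul_le_of_le_one_right (norm_nonneg _) h2

theorem hasSum_integral_inv_pow {Ω : Type*} [MeasurableSpace Ω] {m : Measure Ω}
    {φ p : Ω → ℂ} (hφ : Integrable φ m) (hp : AEStronglyMeasurable p m)
    {μ ρ : ℝ} (hμ : 0 < μ) (hμρ : μ < ρ) (hρ : ∀ ω, ρ ≤ ‖p ω‖) :
    HasSum (fun n : ℕ => ((-μ : ℝ) : ℂ) ^ n * ∫ ω, φ ω * (p ω ^ n)⁻¹ ∂m)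
      (∫ ω, φ ω * p ω / (μ + p ω) ∂m) := by
  have hρ0 : 0 < ρ := hμ.trans hμρ
  have hr1 : μ / ρ < 1 := (div_lt_one hρ0).2 hμρ
  have hr0 : 0 ≤ μ / ρ := by positivity
  simp_rw [← integral_const_mul]
  refine hasSum_integral_of_dominated_convergence
    (fun n ω => ‖φ ω‖ * (μ / ρ) ^ n) ?_ ?_ ?_ ?_ ?_
  · intro n
    exact (hφ.aestronglyMeasurable.mul (hp.pow n).inv₀).const_mul _
  · intro n
    refine .of_forall fun ω => ?_
    simp only [norm_mul, norm_pow, norm_inv, Complex.norm_real, norm_neg, Real.norm_eq_abs,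
      abs_of_pos hμ, div_eq_mul_inv]
    rw [mul_left_comm]
    have := hρ ω
    rw [mul_pow, inv_pow]
    gcongr
  · exact .of_forall fun ω => (summable_geometric_of_lt_one hr0 hr1).mul_left _
  · simp_rw [tsum_mul_left]
    exact hφ.norm.mul_const _
  · refine .of_forall fun ω => ?_
    have hpω : 0 < ‖p ω‖ := hρ0.trans_le (hρ ω)
    have hp0 : p ω ≠ 0 := norm_pos_iff.1 hpω
    have hlt : ‖-(μ : ℂ) / p ω‖ < 1 := by
      rw [norm_div, norm_neg, Complex.norm_real, Real.norm_of_nonneg hμ.le, div_lt_one hpω]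
      exact hμρ.trans_le (hρ ω)
    have h := (hasSum_geometric_of_norm_lt_one hlt).mul_left (φ ω)
    have hne : (μ : ℂ) + p ω ≠ 0 := by
      intro h0
      have : p ω = -μ := by linear_combination h0
      have h1 := hρ ω
      rw [this, norm_neg, Complex.norm_real, Real.norm_of_nonneg hμ.le] at h1
      linarith
    have hsub : 1 - -(μ : ℂ) / p ω = (μ + p ω) / p ω := by
      field_simp
      ring
    rw [hsub, inv_div, ← mul_div_assoc] at h
    refine h.congr_fun fun n => ?_
    push_cast
    rw [div_pow, div_eq_mul_inv]
    ring

/-- The path which comes in from `+∞ - iθ`, crosses the vertical line `re = L` upwards and leaves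
towards `+∞ + iθ`. Its image under `exp` is a Hankel contour. -/
noncomputable def hankelPath (L θ s : ℝ) : ℂ :=
  ⟨max |s| L, θ / L * max (-L) (min s L)⟩

/-- The derivative of `hankelPath L θ` away from the corners `±L`. -/
noncomputable def hankelTangent (L θ s : ℝ) : ℂ :=
  if s ≤ -L then -1 else if s ≤ L then (θ / L : ℝ) * Complex.I else 1

/-- The integral of `H` along `hankelPath L θ`. -/
noncomputable def hankelIntegral (L θ : ℝ) (H : ℂ → ℂ) : ℂ :=
  ∫ s, hankelTangent L θ s * H (hankelPath L θ s)

theorem continuous_hankelPath (L θ : ℝ) : Continuous (hankelPath L θ) := by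
  have h : hankelPath L θ = fun s => ((max |s| L : ℝ) : ℂ) +
      ((θ / L * max (-L) (min s L) : ℝ) : ℂ) * Complex.I := by
    ext s
    exact Complex.mk_eq_add_mul_I _ _
  rw [h]
  fun_prop

theorem measurable_hankelTangent (L θ : ℝ) : Measurable (hankelTangent L θ) :=
  Measurable.ite measurableSet_Iic measurable_const
    (Measurable.ite measurableSet_Iic measurable_const measurable_const)

theorem norm_hankelTangent_le {L θ : ℝ} (hL : 0 < L) (hθ : 0 < θ) (s : ℝ) :
    ‖hankelTangent L θ s‖ ≤ 1 + θ / L := by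
  have : 0 < θ / L := by positivity
  unfold hankelTangent
  split_ifs
  · simp [this.le]
  · rw [norm_mul, Complex.norm_real, Complex.norm_I, Real.norm_of_nonneg this.le]
    linarith
  · simp [this.le]

theorem le_re_hankelPath (L θ s : ℝ) : L ≤ (hankelPath L θ s).re := le_max_right _ _

theorem abs_im_hankelPath_le {L θ : ℝ} (hL : 0 < L) (hθ : 0 < θ) (s : ℝ) :
    |(hankelPath L θ s).im| ≤ θ := by
  have h : |max (-L) (min s L)| ≤ L := by
    rw [abs_le]
    exact ⟨le_max_left _ _, max_le (by linarith) (min_le_right _ _)⟩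
  simp only [hankelPath]
  rw [abs_mul, abs_of_pos (by positivity)]
  calc θ / L * |max (-L) (min s L)| ≤ θ / L * L := by gcongr
    _ = θ := by field_simp

theorem hankelPath_of_ge {L θ s : ℝ} (hL : 0 < L) (hs : L ≤ s) :
    hankelPath L θ s = s + θ * Complex.I := by
  apply Complex.ext
  · simp [hankelPath, abs_of_pos (hL.trans_le hs), hs]
  · simp [hankelPath, hs, max_eq_right (show -L ≤ L by linarith)]
    field_simp

theorem hankelPath_neg_of_ge {L θ s : ℝ} (hL : 0 < L) (hs : L ≤ s) :
    hankelPath L θ (-s) = s + (-θ : ℝ) * Complex.I := by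
  apply Complex.ext
  · simp [hankelPath, abs_of_pos (hL.trans_le hs), hs]
  · simp [hankelPath, hs, min_eq_left (show -s ≤ L by linarith)]
    field_simp

theorem hankelPath_of_mem {L θ s : ℝ} (hs : s ∈ Ioc (-L) L) :
    hankelPath L θ s = L + (s * (θ / L) : ℝ) * Complex.I := by
  apply Complex.ext
  · simp [hankelPath, abs_le.2 ⟨hs.1.le, hs.2⟩]
  · simp [hankelPath, hs.2, hs.1.le, mul_comm]

theorem norm_exp_exp (w : ℂ) :
    ‖Complex.exp (Complex.exp w)‖ = Real.exp (Real.exp w.re * Real.cos w.im) := by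
  rw [Complex.norm_exp, Complex.exp_re]

theorem exp_exp_mul_add_le_exp_neg {κ ν : ℝ} (hκ : κ < 0) (hν : ν < 1) (k : ℝ) :
    ∀ᶠ r : ℝ in atTop, Real.exp (Real.exp r * κ + k * Real.exp (ν * r)) ≤ Real.exp (-r) := by
  have h1 : Tendsto (fun r : ℝ => k * Real.exp (-((1 - ν) * r))) atTop (𝓝 (k * 0)) :=
    (Real.tendsto_exp_neg_atTop_nhds_zero.comp
      (tendsto_id.const_mul_atTop (by linarith))).const_mul k
  have h2 : Tendsto (fun r : ℝ => r * Real.exp (-r)) atTop (𝓝 0) := by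
    simpa using Real.tendsto_pow_mul_exp_neg_atTop_nhds_zero 1
  have h3 := h1.add h2
  simp only [mul_zero, add_zero] at h3
  filter_upwards [h3.eventually_le_const (show 0 < -κ by linarith)] with r hr
  rw [Real.exp_le_exp]
  have e1 : Real.exp r * Real.exp (-((1 - ν) * r)) = Real.exp (ν * r) := by
    rw [← Real.exp_add]
    ring_nf
  have e2 : Real.exp r * Real.exp (-r) = 1 := by rw [← Real.exp_add]; simp
  have := mul_le_mul_of_nonneg_left hr (Real.exp_pos r).le
  linear_combination this - k * e1 - r * e2

theorem integrable_hankel {L θ ν : ℝ} (hL : 0 < L) (hcos : Real.cos θ < 0) (hν : ν < 1) (k : ℝ) :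
    Integrable fun s => ‖Complex.exp (Complex.exp (hankelPath L θ s))‖ *
      Real.exp (k * ‖Complex.exp (ν * hankelPath L θ s)‖) := by
  have hcont := continuous_hankelPath L θ
  have hval : ∀ s, L ≤ s → ∀ w : ℂ, w.re = s → Real.cos w.im = Real.cos θ →
      ‖Complex.exp (Complex.exp w)‖ * Real.exp (k * ‖Complex.exp (ν * w)‖)
        = Real.exp (Real.exp s * Real.cos θ + k * Real.exp (ν * s)) := by
    intro s hs w hw hw'
    rw [norm_exp_exp, hw, hw', Complex.norm_exp, Complex.re_ofReal_mul, hw, Real.exp_add]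
  refine LocallyIntegrable.integrable_of_isBigO_atTop_of_norm_isNegInvariant
    (g := fun s : ℝ => Real.exp (-s)) (Continuous.locallyIntegrable (by fun_prop))
    (.of_forall fun s => ?_) ?_
    ⟨Ioi 0, Ioi_mem_atTop 0, by simpa using exp_neg_integrableOn_Ioi 0 one_pos⟩
  · have h : hankelPath L θ (-s) = (starRingEnd ℂ) (hankelPath L θ s) := by
      apply Complex.ext
      · simp [hankelPath]
      · simp only [hankelPath, Complex.conj_im]
        rw [← mul_neg, ← min_neg_neg, neg_neg, ← max_neg_neg]
        congr 1
        rcases le_total s (-L) with h | h <;> rcases le_total s L with h' | h' <;>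
          simp [min_def, max_def] <;> split_ifs <;> linarith
    simp [h, Complex.norm_exp]
  · refine IsBigO.of_bound' ?_
    filter_upwards [exp_exp_mul_add_le_exp_neg hcos hν k, eventually_ge_atTop L] with s hs hsL
    rw [Real.norm_of_nonneg (by positivity), Real.norm_of_nonneg (by positivity),
      hval s hsL _ (by simp [hankelPath_of_ge hL hsL]) (by simp [hankelPath_of_ge hL hsL])]
    exact hs

theorem hankelTangent_of_gt {L θ s : ℝ} (hL : 0 < L) (hs : L < s) : hankelTangent L θ s = 1 := by
  rw [hankelTangent, if_neg (by linarith), if_neg (by linarith)]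

theorem hankelTangent_neg_of_gt {L θ s : ℝ} (hs : L < s) : hankelTangent L θ (-s) = -1 := by
  rw [hankelTangent, if_pos (by linarith)]

theorem hankelIntegral_eq {L θ : ℝ} (hL : 0 < L) {H : ℂ → ℂ}
    (hH : Integrable fun s => hankelTangent L θ s * H (hankelPath L θ s)) :
    hankelIntegral L θ H = (∫ u in Ioi L, H (u + θ * Complex.I))
      - (∫ u in Ioi L, H (u + (-θ : ℝ) * Complex.I))
      + Complex.I * ∫ y in (-θ)..θ, H (L + y * Complex.I) := by
  have hLL : -L ≤ L := by linarith
  have h1 : ∫ s in Iic (-L), hankelTangent L θ s * H (hankelPath L θ s)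
      = -∫ u in Ioi L, H (u + (-θ : ℝ) * Complex.I) := by
    rw [← integral_comp_neg_Ioi, ← integral_neg]
    refine setIntegral_congr_fun measurableSet_Ioi fun s hs => ?_
    simp only [hankelTangent_neg_of_gt hs, hankelPath_neg_of_ge hL (le_of_lt hs), neg_one_mul]
  have h2 : ∫ s in (-L)..L, hankelTangent L θ s * H (hankelPath L θ s)
      = Complex.I * ∫ y in (-θ)..θ, H (L + y * Complex.I) := by
    have h := intervalIntegral.smul_integral_comp_mul_right (a := -L) (b := L)
      (fun y : ℝ => H (L + y * Complex.I)) (θ / L)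
    rw [neg_mul, mul_div_cancel₀ _ hL.ne'] at h
    rw [← h, Complex.real_smul, ← mul_assoc, ← intervalIntegral.integral_const_mul,
      intervalIntegral.integral_of_le hLL, intervalIntegral.integral_of_le hLL]
    refine setIntegral_congr_fun measurableSet_Ioc fun s hs => ?_
    simp only [hankelPath_of_mem hs]
    rw [hankelTangent, if_neg (not_le.2 hs.1), if_pos hs.2, mul_comm Complex.I]
  have h3 : ∫ s in Ioi L, hankelTangent L θ s * H (hankelPath L θ s)
      = ∫ u in Ioi L, H (u + θ * Complex.I) := by
    refine setIntegral_congr_fun measurableSet_Ioi fun s hs => ?_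
    simp only [hankelTangent_of_gt hL hs, hankelPath_of_ge hL (le_of_lt hs), one_mul]
  have h4 := intervalIntegral.integral_Iic_sub_Iic (a := -L) (b := L) hH.integrableOn
    hH.integrableOn
  rw [hankelIntegral, ← intervalIntegral.integral_Iic_add_Ioi (b := L) hH.integrableOn
    hH.integrableOn, h3]
  linear_combination h4 + h1 + h2

theorem integrableOn_of_hankel {L θ : ℝ} (hL : 0 < L) {H : ℂ → ℂ}
    (hH : Integrable fun s => hankelTangent L θ s * H (hankelPath L θ s)) :
    IntegrableOn (fun u : ℝ => H (u + θ * Complex.I)) (Ioi L) ∧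
      IntegrableOn (fun u : ℝ => H (u + (-θ : ℝ) * Complex.I)) (Ioi L) := by
  constructor
  · refine hH.integrableOn.congr_fun (fun s hs => ?_) measurableSet_Ioi
    simp only [hankelTangent_of_gt hL hs, hankelPath_of_ge hL (le_of_lt hs), one_mul]
  · refine hH.comp_neg.neg.integrableOn.congr_fun (fun s hs => ?_) measurableSet_Ioi
    simp only [Pi.neg_apply, hankelTangent_neg_of_gt hs, hankelPath_neg_of_ge hL (le_of_lt hs),
      neg_one_mul, neg_neg]

theorem hankelIntegral_deriv {L θ : ℝ} (hL : 0 < L) (hθ : 0 < θ) {H H' : ℂ → ℂ}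
    (hd : ∀ w, HasDerivAt H (H' w) w) (hc : Continuous H')
    (hH : Integrable fun s => hankelTangent L θ s * H' (hankelPath L θ s))
    (htop : ∀ α : ℝ, |α| = θ → Tendsto (fun u : ℝ => H (u + α * Complex.I)) atTop (𝓝 0)) :
    hankelIntegral L θ H' = 0 := by
  obtain ⟨hi1, hi2⟩ := integrableOn_of_hankel hL hH
  have hray : ∀ α : ℝ, |α| = θ → IntegrableOn (fun u : ℝ => H' (u + α * Complex.I)) (Ioi L) →
      ∫ u in Ioi L, H' (u + α * Complex.I) = 0 - H (L + α * Complex.I) := fun α hα hi =>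
    integral_Ioi_of_hasDerivAt_of_tendsto' (f := fun u : ℝ => H (u + α * Complex.I))
      (fun x _ => by
        simpa using (hd (x + α * Complex.I)).comp_add_const (x : ℂ) (α * Complex.I)
          |>.comp_ofReal) hi (htop α hα)
  have hseg : ∫ y in (-θ)..θ, Complex.I * H' (L + y * Complex.I)
      = H (L + θ * Complex.I) - H (L + (-θ : ℝ) * Complex.I) := by
    refine intervalIntegral.integral_eq_sub_of_hasDerivAt
      (f := fun y : ℝ => H (L + y * Complex.I)) (fun y _ => ?_)
      (Continuous.intervalIntegrable (by fun_prop) _ _)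
    have h1 : HasDerivAt (fun z : ℂ => (L : ℂ) + z * Complex.I) Complex.I y := by
      simpa using ((hasDerivAt_id (y : ℂ)).mul_const Complex.I).const_add (L : ℂ)
    have h2 := (hd (L + y * Complex.I)).comp (y : ℂ) h1
    rw [mul_comm]
    exact h2.comp_ofReal
  rw [hankelIntegral_eq hL hH, hray θ (abs_of_pos hθ) hi1,
    hray (-θ) (by rw [abs_neg, abs_of_pos hθ]) hi2, ← intervalIntegral.integral_const_mul, hseg]
  ring

theorem hankelIntegral_eq_of_tendsto {L θ : ℝ} (hL : 0 < L) {H : ℂ → ℂ}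
    (hd : Differentiable ℂ H)
    (hH : Integrable fun s => hankelTangent L θ s * H (hankelPath L θ s))
    (h1 : Integrable fun u : ℝ => H (u + θ * Complex.I))
    (h2 : Integrable fun u : ℝ => H (u + (-θ : ℝ) * Complex.I))
    (hbot : Tendsto (fun l : ℝ => ∫ y in (-θ)..θ, H (l + y * Complex.I)) atBot (𝓝 0)) :
    hankelIntegral L θ H = (∫ u : ℝ, H (u + θ * Complex.I))
      - ∫ u : ℝ, H (u + (-θ : ℝ) * Complex.I) := by
  have t1 := intervalIntegral_tendsto_integral_Iic L h1.integrableOn tendsto_id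
  have t2 := intervalIntegral_tendsto_integral_Iic L h2.integrableOn tendsto_id
  have hrect : ∀ l : ℝ, _ := fun l => Complex.integral_boundary_rect_eq_zero_of_differentiableOn H
    (l + (-θ : ℝ) * Complex.I) (L + θ * Complex.I) hd.differentiableOn
  simp only [Complex.ofReal_re, Complex.ofReal_im, Complex.add_re, Complex.add_im,
    Complex.re_ofReal_mul, Complex.im_ofReal_mul, Complex.I_re, Complex.I_im, mul_zero, mul_one,
    add_zero, zero_add, smul_eq_mul] at hrect
  have hlim := ((t2.sub t1).add_const
    (Complex.I * ∫ y in (-θ)..θ, H (L + y * Complex.I))).sub (hbot.const_mul Complex.I)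
  have := tendsto_nhds_unique hlim (tendsto_const_nhds.congr fun l => (hrect l).symm)
  rw [hankelIntegral_eq hL hH,
    ← intervalIntegral.integral_Iic_add_Ioi (b := L) h1.integrableOn h1.integrableOn,
    ← intervalIntegral.integral_Iic_add_Ioi (b := L) h2.integrableOn h2.integrableOn]
  linear_combination this

theorem integrable_exp_neg_mul_exp {b c : ℝ} (hb : 0 < b) (hc : 0 < c) :
    Integrable fun x : ℝ => Real.exp (-(c * Real.exp x)) * Real.exp (b * x) := by
  have h := integrableOn_image_iff_integrableOn_abs_deriv_smul (s := univ) MeasurableSet.univ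
    (fun x _ => (Real.hasDerivAt_exp x).hasDerivWithinAt) Real.exp_injective.injOn
    (fun t : ℝ => t ^ (b - 1) * Real.exp (-c * t ^ (1 : ℝ)))
  rw [image_univ, Real.range_exp, integrableOn_univ] at h
  refine (h.1 (integrableOn_rpow_mul_exp_neg_mul_rpow (by linarith) one_pos hc)).congr
    (.of_forall fun x => ?_)
  simp only [abs_of_pos (Real.exp_pos x), smul_eq_mul, Real.rpow_one, ← Real.exp_mul]
  rw [← mul_assoc, ← Real.exp_add, mul_comm]
  ring_nf

theorem integral_exp_neg_exp_mul_exp {b : ℝ} (hb : 0 < b) :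
    ∫ x : ℝ, Real.exp (-Real.exp x) * Real.exp (b * x) = Real.Gamma b := by
  have h := integral_image_eq_integral_abs_deriv_smul (s := univ) MeasurableSet.univ
    (fun x _ => (Real.hasDerivAt_exp x).hasDerivWithinAt) Real.exp_injective.injOn
    (fun t : ℝ => Real.exp (-t) * t ^ (b - 1))
  rw [image_univ, Real.range_exp, setIntegral_univ] at h
  rw [Real.Gamma_eq_integral hb, h]
  refine integral_congr_ae (.of_forall fun x => ?_)
  simp only [abs_of_pos (Real.exp_pos x), smul_eq_mul, ← Real.exp_mul, ← Real.exp_add]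
  ring_nf

theorem tendsto_exp_neg_mul_exp_atTop (b : ℝ) {c : ℝ} (hc : 0 < c) :
    Tendsto (fun x : ℝ => Real.exp (-(c * Real.exp x)) * Real.exp (b * x)) atTop (𝓝 0) := by
  refine ((tendsto_rpow_mul_exp_neg_mul_atTop_nhds_zero b c hc).comp
    Real.tendsto_exp_atTop).congr fun x => ?_
  simp only [Function.comp_apply, ← Real.exp_mul, mul_comm]
  ring_nf

theorem tendsto_exp_neg_mul_exp_atBot {b c : ℝ} (hb : 0 < b) (hc : 0 < c) :
    Tendsto (fun x : ℝ => Real.exp (-(c * Real.exp x)) * Real.exp (b * x)) atBot (𝓝 0) := by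
  refine squeeze_zero (fun x => by positivity) (fun x => ?_)
    (Real.tendsto_exp_atBot.comp (tendsto_id.const_mul_atBot hb))
  refine mul_le_of_le_one_left (by positivity) (Real.exp_le_one_iff.2 ?_)
  have : 0 < c * Real.exp x := by positivity
  linarith

theorem norm_exp_neg_exp_mul_exp_le (b : ℝ) {β y : ℝ} (hβ : |β| < π / 2) (hy : |y| ≤ |β|)
    (x : ℝ) :
    ‖Complex.exp (-Complex.exp (x + y * Complex.I)) * Complex.exp (b * (x + y * Complex.I))‖
      ≤ Real.exp (-(Real.cos β * Real.exp x)) * Real.exp (b * x) := by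
  have hcos : Real.cos β ≤ Real.cos y := by
    rw [← Real.cos_abs β, ← Real.cos_abs y]
    exact Real.cos_le_cos_of_nonneg_of_le_pi (abs_nonneg _) (by linarith [Real.pi_pos]) hy
  have := Real.exp_pos x
  rw [norm_mul, Complex.norm_exp, Complex.norm_exp]
  simp only [Complex.neg_re, Complex.exp_re, Complex.add_re, Complex.add_im, Complex.ofReal_re,
    Complex.ofReal_im, Complex.re_ofReal_mul, Complex.im_ofReal_mul, Complex.I_re, Complex.I_im,
    mul_zero, mul_one, add_zero, zero_add]
  rw [mul_comm (Real.exp x)]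
  gcongr

theorem integral_exp_neg_exp_mul_exp_shift {b β : ℝ} (hb : 0 < b) (hβ : |β| < π / 2) :
    Integrable (fun x : ℝ => Complex.exp (-Complex.exp (x + β * Complex.I)) *
        Complex.exp (b * (x + β * Complex.I))) ∧
      ∫ x : ℝ, Complex.exp (-Complex.exp (x + β * Complex.I)) *
        Complex.exp (b * (x + β * Complex.I)) = Real.Gamma b := by
  set G : ℂ → ℂ := fun w => Complex.exp (-Complex.exp w) * Complex.exp (b * w) with hG
  have hc : 0 < Real.cos β := Real.cos_pos_of_mem_Ioo (by rwa [mem_Ioo, ← abs_lt])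
  have hbound : ∀ y : ℝ, |y| ≤ |β| → ∀ x : ℝ, ‖G (x + y * Complex.I)‖
      ≤ Real.exp (-(Real.cos β * Real.exp x)) * Real.exp (b * x) :=
    fun y hy x => norm_exp_neg_exp_mul_exp_le b hβ hy x
  have hint : ∀ y : ℝ, |y| ≤ |β| → Integrable fun x : ℝ => G (x + y * Complex.I) := fun y hy =>
    (integrable_exp_neg_mul_exp hb hc).mono'
      (Continuous.aestronglyMeasurable (by fun_prop)) (.of_forall (hbound y hy))
  have hvert : ∀ x : ℝ, ‖∫ y in (0 : ℝ)..β, G (x + y * Complex.I)‖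
      ≤ Real.exp (-(Real.cos β * Real.exp x)) * Real.exp (b * x) * |β - 0| := fun x => by
    refine intervalIntegral.norm_integral_le_of_norm_le_const fun y hy => hbound y ?_ x
    have := abs_sub_left_of_mem_uIcc (uIoc_subset_uIcc hy)
    simpa using this
  have hvert0 : ∀ {l : Filter ℝ} {f : ℝ → ℝ}, Tendsto (fun R => Real.exp (-(Real.cos β *
      Real.exp (f R))) * Real.exp (b * f R)) l (𝓝 0) →
      Tendsto (fun R => ∫ y in (0 : ℝ)..β, G (f R + y * Complex.I)) l (𝓝 0) := by
    intro l f hf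
    refine squeeze_zero_norm (fun R => hvert (f R)) ?_
    simpa using hf.mul_const |β - 0|
  have htop := hvert0 (f := id) (tendsto_exp_neg_mul_exp_atTop b hc)
  have hbot := hvert0 (l := atTop) (f := fun R => -R)
    ((tendsto_exp_neg_mul_exp_atBot hb hc).comp tendsto_neg_atTop_atBot)
  have h0 := intervalIntegral_tendsto_integral (hint 0 (by simp)) tendsto_neg_atTop_atBot tendsto_id
  have h1 := intervalIntegral_tendsto_integral (hint β le_rfl) tendsto_neg_atTop_atBot tendsto_id
  refine ⟨hint β le_rfl, ?_⟩
  have hzero := (((h0.sub h1).add (htop.const_mul Complex.I)).sub (hbot.const_mul Complex.I))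
  have hrect : ∀ R : ℝ, _ := fun R => Complex.integral_boundary_rect_eq_zero_of_differentiableOn G
    (-R : ℝ) (R + β * Complex.I) (by fun_prop)
  simp only [Complex.ofReal_re, Complex.ofReal_im, Complex.add_re, Complex.add_im,
    Complex.re_ofReal_mul, Complex.im_ofReal_mul, Complex.I_re, Complex.I_im, mul_zero, mul_one,
    add_zero, zero_add, smul_eq_mul] at hrect
  have := tendsto_nhds_unique hzero (tendsto_const_nhds.congr fun R => (hrect R).symm)
  have hre : ∫ x : ℝ, G (x + (0 : ℝ) * Complex.I) = Real.Gamma b := by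
    rw [← integral_exp_neg_exp_mul_exp hb, ← integral_complex_ofReal]
    simp [hG]
  rw [← hre]
  linear_combination -this

theorem integral_exp_exp_mul_exp {b α β : ℝ} (hb : 0 < b) (hβ : |β| < π / 2)
    (hα : Complex.exp ((α - β : ℝ) * Complex.I) = -1) :
    Integrable (fun x : ℝ => Complex.exp (Complex.exp (x + α * Complex.I)) *
        Complex.exp (b * (x + α * Complex.I))) ∧
      ∫ x : ℝ, Complex.exp (Complex.exp (x + α * Complex.I)) *
        Complex.exp (b * (x + α * Complex.I))
        = Complex.exp (b * (α - β : ℝ) * Complex.I) * Real.Gamma b := by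
  have h : ∀ x : ℝ, Complex.exp (Complex.exp (x + α * Complex.I)) *
      Complex.exp (b * (x + α * Complex.I)) = Complex.exp (b * (α - β : ℝ) * Complex.I) *
        (Complex.exp (-Complex.exp (x + β * Complex.I)) *
          Complex.exp (b * (x + β * Complex.I))) := by
    intro x
    have e1 : Complex.exp (x + α * Complex.I) = -Complex.exp (x + β * Complex.I) := by
      rw [← neg_one_mul, ← hα, ← Complex.exp_add]
      push_cast
      ring_nf
    have e2 : Complex.exp (b * (x + α * Complex.I)) =
        Complex.exp (b * (α - β : ℝ) * Complex.I) * Complex.exp (b * (x + β * Complex.I)) := by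
      rw [← Complex.exp_add]
      push_cast
      ring_nf
    rw [e1, e2, mul_left_comm]
  obtain ⟨h1, h2⟩ := integral_exp_neg_exp_mul_exp_shift hb hβ
  simp_rw [h]
  exact ⟨h1.const_mul _, by rw [integral_const_mul, h2]⟩

theorem norm_hankel_mul_exp_le {L θ : ℝ} (hL : 0 < L) (hθ : 0 < θ) {c A : ℝ} (hc : |c| ≤ A)
    (s : ℝ) :
    ‖hankelTangent L θ s * (Complex.exp (Complex.exp (hankelPath L θ s)) *
        Complex.exp (c * hankelPath L θ s))‖
      ≤ (1 + θ / L) * (‖Complex.exp (Complex.exp (hankelPath L θ s))‖ *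
        Real.exp (2 * A * ‖Complex.exp ((1 / 2 : ℝ) * hankelPath L θ s)‖)) := by
  have hre : 0 < (hankelPath L θ s).re := hL.trans_le (le_re_hankelPath L θ s)
  have hA : 0 ≤ A := (abs_nonneg c).trans hc
  have hexp : ‖Complex.exp (c * hankelPath L θ s)‖
      ≤ Real.exp (2 * A * ‖Complex.exp ((1 / 2 : ℝ) * hankelPath L θ s)‖) := by
    rw [Complex.norm_exp, Complex.norm_exp, Complex.re_ofReal_mul, Complex.re_ofReal_mul,
      Real.exp_le_exp]
    calc c * (hankelPath L θ s).re ≤ A * (hankelPath L θ s).re := by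
          gcongr
          exact (le_abs_self c).trans hc
      _ = 2 * A * (1 / 2 * (hankelPath L θ s).re) := by ring
      _ ≤ _ := by
          gcongr
          linarith [Real.add_one_le_exp (1 / 2 * (hankelPath L θ s).re)]
  rw [norm_mul, norm_mul]
  have := norm_hankelTangent_le hL hθ s
  gcongr

theorem aestronglyMeasurable_hankel_mul_exp (L θ c : ℝ) :
    AEStronglyMeasurable fun s : ℝ => hankelTangent L θ s *
      (Complex.exp (Complex.exp (hankelPath L θ s)) * Complex.exp (c * hankelPath L θ s)) := by
  have := continuous_hankelPath L θ
  exact (measurable_hankelTangent L θ).aestronglyMeasurable.mul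
    (Continuous.aestronglyMeasurable (by fun_prop))

theorem integrable_hankel_mul_exp {L θ : ℝ} (hL : 0 < L) (hθ : 0 < θ) (hcos : Real.cos θ < 0)
    (c : ℝ) :
    Integrable fun s : ℝ => hankelTangent L θ s *
      (Complex.exp (Complex.exp (hankelPath L θ s)) * Complex.exp (c * hankelPath L θ s)) :=
  ((integrable_hankel hL hcos (ν := 1 / 2) (by norm_num) (2 * |c|)).const_mul _).mono'
    (aestronglyMeasurable_hankel_mul_exp L θ c)
    (.of_forall (norm_hankel_mul_exp_le hL hθ le_rfl))

theorem continuous_hankelIntegral_exp {L θ : ℝ} (hL : 0 < L) (hθ : 0 < θ) (hcos : Real.cos θ < 0) :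
    Continuous fun c : ℝ => hankelIntegral L θ fun w =>
      Complex.exp (Complex.exp w) * Complex.exp (c * w) := by
  refine continuous_iff_continuousAt.2 fun c₀ => ?_
  refine continuousAt_of_dominated (.of_forall (aestronglyMeasurable_hankel_mul_exp L θ)) ?_
    ((integrable_hankel hL hcos (ν := 1 / 2) (by norm_num) (2 * (|c₀| + 1))).const_mul
      (1 + θ / L)) (.of_forall fun s => Continuous.continuousAt (by fun_prop))
  filter_upwards [(continuous_abs.tendsto c₀).eventually_le_const (lt_add_one |c₀|)] with c hc
  exact .of_forall (norm_hankel_mul_exp_le hL hθ hc)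

theorem hankelIntegral_exp_of_pos {L θ c : ℝ} (hL : 0 < L) (hθ₁ : π / 2 < θ) (hθ₂ : θ < π)
    (hc : 0 < c) :
    hankelIntegral L θ (fun w => Complex.exp (Complex.exp w) * Complex.exp (c * w))
      = 2 * π * Complex.I * ((Real.Gamma (1 - c))⁻¹ : ℝ) := by
  have hπ := Real.pi_pos
  have hθ : 0 < θ := by linarith
  have hcos : Real.cos θ < 0 := Real.cos_neg_of_pi_div_two_lt_of_lt hθ₁ (by linarith)
  obtain ⟨i1, e1⟩ := integral_exp_exp_mul_exp (b := c) (α := θ) (β := θ - π) hc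
    (by rw [abs_lt]; constructor <;> linarith) (by simp)
  obtain ⟨i2, e2⟩ := integral_exp_exp_mul_exp (b := c) (α := -θ) (β := -(θ - π)) hc
    (by rw [abs_lt]; constructor <;> linarith)
    (by rw [show -θ - -(θ - π) = -π by ring]; simp [Complex.exp_neg])
  rw [hankelIntegral_eq_of_tendsto hL (by fun_prop) (integrable_hankel_mul_exp hL hθ hcos c) i1 i2,
    e1, e2]
  · have hG : (Real.Gamma (1 - c))⁻¹ = Real.Gamma c * Real.sin (π * c) / π := by
      have h := congrArg Inv.inv (Real.Gamma_mul_Gamma_one_sub c)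
      have h0 := (Real.Gamma_pos_of_pos hc).ne'
      rw [mul_inv, inv_div] at h
      rw [mul_div_assoc, ← h, mul_inv_cancel_left₀ h0]
    have hs : Complex.exp (c * (θ - (θ - π) : ℝ) * Complex.I) -
        Complex.exp (c * (-θ - -(θ - π) : ℝ) * Complex.I)
        = 2 * Complex.I * Complex.sin (π * c) := by
      have h := Complex.two_sin (π * c)
      have e3 : (c * (θ - (θ - π) : ℝ) * Complex.I : ℂ) = π * c * Complex.I := by
        push_cast
        ring
      have e4 : (c * (-θ - -(θ - π) : ℝ) * Complex.I : ℂ) = -(π * c) * Complex.I := by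
        push_cast
        ring
      rw [e3, e4]
      linear_combination -Complex.I * h + (Complex.exp (π * c * Complex.I) -
        Complex.exp (-(π * c) * Complex.I)) * Complex.I_mul_I
    rw [← sub_mul, hs, hG]
    have : (π : ℂ) ≠ 0 := by exact_mod_cast hπ.ne'
    push_cast
    field_simp
  · refine squeeze_zero_norm (a := fun l : ℝ => Real.exp (Real.exp l) * Real.exp (c * l) *
      |θ - -θ|) (fun l => intervalIntegral.norm_integral_le_of_norm_le_const fun y _ => ?_) ?_
    · rw [norm_mul, norm_exp_exp, Complex.norm_exp]
      have := Real.cos_le_one y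
      have := Real.exp_pos l
      simp only [Complex.add_re, Complex.add_im, Complex.ofReal_re,
        Complex.ofReal_im, Complex.re_ofReal_mul, Complex.im_ofReal_mul, Complex.I_re,
        Complex.I_im, mul_zero, mul_one, add_zero, zero_add]
      gcongr
      nlinarith
    · have h1 := (Real.continuous_exp.tendsto 0).comp Real.tendsto_exp_atBot
      have h2 := Real.tendsto_exp_atBot.comp (tendsto_id.const_mul_atBot hc)
      simpa using (h1.mul h2).mul_const |θ - -θ|

theorem hankelIntegral_exp_add_one {L θ : ℝ} (hL : 0 < L) (hθ : 0 < θ) (hcos : Real.cos θ < 0)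
    (c : ℝ) :
    hankelIntegral L θ (fun w => Complex.exp (Complex.exp w) * Complex.exp ((c + 1 : ℝ) * w))
      = -c * hankelIntegral L θ fun w => Complex.exp (Complex.exp w) * Complex.exp (c * w) := by
  have hi := integrable_hankel_mul_exp hL hθ hcos
  have hsplit : ∀ s : ℝ, hankelTangent L θ s * ((fun w : ℂ => Complex.exp (Complex.exp w) *
      Complex.exp ((c + 1 : ℝ) * w) + c * (Complex.exp (Complex.exp w) * Complex.exp (c * w)))
        (hankelPath L θ s)) = hankelTangent L θ s * (Complex.exp (Complex.exp (hankelPath L θ s)) *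
      Complex.exp ((c + 1 : ℝ) * hankelPath L θ s)) + c * (hankelTangent L θ s *
        (Complex.exp (Complex.exp (hankelPath L θ s)) * Complex.exp (c * hankelPath L θ s))) :=
    fun s => by ring
  have h := hankelIntegral_deriv hL hθ
    (H := fun w => Complex.exp (Complex.exp w) * Complex.exp (c * w))
    (H' := fun w => Complex.exp (Complex.exp w) * Complex.exp ((c + 1 : ℝ) * w) +
      c * (Complex.exp (Complex.exp w) * Complex.exp (c * w))) (fun w => ?_) (by fun_prop)
    (by simp_rw [hsplit]; exact (hi _).add ((hi c).const_mul _)) (fun α hα => ?_)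
  · rw [hankelIntegral] at h
    simp_rw [hsplit] at h
    rw [integral_add (hi _) ((hi c).const_mul _), integral_const_mul] at h
    simp only [hankelIntegral]
    linear_combination h
  · have h1 := (Complex.hasDerivAt_exp w).cexp
    have h2 := ((hasDerivAt_id w).const_mul (c : ℂ)).cexp
    convert! h1.mul h2 using 1
    have : Complex.exp ((c + 1 : ℝ) * w) = Complex.exp w * Complex.exp (c * w) := by
      rw [← Complex.exp_add]
      push_cast
      ring_nf
    rw [this]
    simp only [id]
    ring
  · refine squeeze_zero_norm (fun u => le_of_eq ?_)
      (tendsto_exp_neg_mul_exp_atTop c (neg_pos.2 hcos))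
    rw [norm_mul, norm_exp_exp, Complex.norm_exp]
    have : Real.cos α = Real.cos θ := by rw [← hα, Real.cos_abs]
    simp [this, mul_comm]

/-- Hankel's representation of the reciprocal Gamma function. -/
theorem hankelIntegral_exp {L θ : ℝ} (hL : 0 < L) (hθ₁ : π / 2 < θ) (hθ₂ : θ < π) (c : ℝ) :
    hankelIntegral L θ (fun w => Complex.exp (Complex.exp w) * Complex.exp (c * w))
      = 2 * π * Complex.I * ((Real.Gamma (1 - c))⁻¹ : ℝ) := by
  have hθ : 0 < θ := by linarith [Real.pi_pos]
  have hcos : Real.cos θ < 0 :=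
    Real.cos_neg_of_pi_div_two_lt_of_lt hθ₁ (by linarith [Real.pi_pos])
  have hpos := fun c => hankelIntegral_exp_of_pos (c := c) hL hθ₁ hθ₂
  suffices ∀ n : ℕ, ∀ c : ℝ, -(n : ℝ) < c →
      hankelIntegral L θ (fun w => Complex.exp (Complex.exp w) * Complex.exp (c * w))
        = 2 * π * Complex.I * ((Real.Gamma (1 - c))⁻¹ : ℝ) by
    obtain ⟨n, hn⟩ := exists_nat_gt (-c)
    exact this n c (by linarith)
  intro n
  induction n with
  | zero => exact fun c hc => hpos c (by simpa using hc)
  | succ n ih =>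
    intro c hc
    push_cast at hc
    rcases eq_or_ne c 0 with rfl | hc0
    · have h1 := ((continuous_hankelIntegral_exp hL hθ hcos).tendsto 0).mono_left
        (nhdsWithin_le_nhds (s := Ioi 0))
      have hG : ContinuousAt (fun c : ℝ => (Real.Gamma (1 - c))⁻¹) 0 := by
        refine ContinuousAt.inv₀ (ContinuousAt.comp (g := Real.Gamma) ?_ (by fun_prop)) (by simp)
        have h : DifferentiableAt ℝ Real.Gamma 1 :=
          Real.differentiableAt_Gamma fun m => ((neg_nonpos.2 m.cast_nonneg).trans_lt one_pos).ne'
        simpa using h.continuousAt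
      have h2 := ((Complex.continuous_ofReal.tendsto _).comp
        (hG.tendsto.mono_left (nhdsWithin_le_nhds (s := Ioi 0)))).const_mul (2 * π * Complex.I)
      refine tendsto_nhds_unique h1 (h2.congr' ?_)
      filter_upwards [self_mem_nhdsWithin] with c hc
      exact (hpos c hc).symm
    · have h := hankelIntegral_exp_add_one hL hθ hcos c
      rw [ih (c + 1) (by linarith), show 1 - (c + 1) = -c by ring] at h
      have hG : Real.Gamma (1 - c) = -c * Real.Gamma (-c) := by
        rw [← Real.Gamma_add_one (neg_ne_zero.2 hc0), neg_add_eq_sub]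
      have hcc : (c : ℂ) ≠ 0 := by exact_mod_cast hc0
      have h' : hankelIntegral L θ (fun w => Complex.exp (Complex.exp w) * Complex.exp (c * w))
          = (-c : ℂ)⁻¹ * (2 * π * Complex.I * ((Real.Gamma (-c))⁻¹ : ℝ)) := by
        rw [h, inv_mul_cancel_left₀ (neg_ne_zero.2 hcc)]
      rw [h', hG, mul_inv]
      push_cast
      ring

theorem integral_exp_mul_wright {ν μ : ℝ} (hν : ν ∈ Ioo (0 : ℝ) 1) (hμ : 0 < μ) :
    ∫ x in Ioi (0 : ℝ), Real.exp (-μ * x) * wright (-ν) (1 - ν) (-x) = mittagLeffler ν 1 (-μ) := by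
  obtain ⟨hν0, hν1⟩ := hν
  have hπ := Real.pi_pos
  set θ : ℝ := π / (1 + ν) with hθdef
  have hθ₁ : π / 2 < θ := by
    rw [hθdef]
    gcongr
    linarith
  have hθ₂ : θ < π := div_lt_self hπ (by linarith)
  have hνθ : ν * θ < π / 2 := by
    have : ν * θ + θ = π := by
      rw [hθdef]
      field_simp
      ring
    linarith
  have hθ : 0 < θ := by linarith
  have hcos : Real.cos θ < 0 := Real.cos_neg_of_pi_div_two_lt_of_lt hθ₁ (by linarith)
  set L : ℝ := (μ + 1) / ν with hLdef
  have hL : 0 < L := by positivity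
  set φ : ℝ → ℂ := fun s => hankelTangent L θ s * Complex.exp (Complex.exp (hankelPath L θ s))
  set p : ℝ → ℂ := fun s => Complex.exp (ν * hankelPath L θ s) with hp
  have hcont := continuous_hankelPath L θ
  have hφm : AEStronglyMeasurable φ := (measurable_hankelTangent L θ).aestronglyMeasurable.mul
    (Continuous.aestronglyMeasurable (by fun_prop))
  have hpm : AEStronglyMeasurable p := Continuous.aestronglyMeasurable (by fun_prop)
  have hint : ∀ k : ℝ, 0 ≤ k → Integrable fun s => ‖φ s‖ * Real.exp (k * ‖p s‖) := by
    intro k _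
    refine ((integrable_hankel hL hcos hν1 k).const_mul (1 + θ / L)).mono' ?_
      (.of_forall fun s => ?_)
    · exact hφm.norm.mul (Real.continuous_exp.comp_aestronglyMeasurable (hpm.norm.const_mul k))
    · have := norm_hankelTangent_le hL hθ s
      rw [Real.norm_of_nonneg (by positivity), norm_mul, mul_assoc]
      gcongr
  have hφi : Integrable φ := by
    have := hint 0 le_rfl
    simp only [zero_mul, Real.exp_zero, mul_one] at this
    exact (integrable_norm_iff hφm).1 this
  have hre : ∀ s, 0 ≤ (p s).re := by
    intro s
    have h1 := abs_im_hankelPath_le hL hθ s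
    have h2 : |ν * (hankelPath L θ s).im| ≤ π / 2 := by
      rw [abs_mul, abs_of_pos hν0]
      exact (mul_le_mul_of_nonneg_left h1 hν0.le).trans hνθ.le
    rw [hp, Complex.exp_re, Complex.im_ofReal_mul]
    exact mul_nonneg (Real.exp_pos _).le (Real.cos_nonneg_of_mem_Icc (abs_le.1 h2))
  have hρ : ∀ s, μ + 1 ≤ ‖p s‖ := by
    intro s
    have h1 : μ + 1 ≤ ν * (hankelPath L θ s).re := by
      have := mul_le_mul_of_nonneg_left (le_re_hankelPath L θ s) hν0.le
      rwa [hLdef, mul_div_cancel₀ _ hν0.ne'] at this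
    rw [hp, Complex.norm_exp, Complex.re_ofReal_mul]
    linarith [Real.add_one_le_exp (ν * (hankelPath L θ s).re)]
  have hA : ∀ j : ℕ, ∫ s, φ s * p s ^ (j + 1)
      = 2 * π * Complex.I * ((Real.Gamma (-ν * j + (1 - ν)))⁻¹ : ℝ) := by
    intro j
    rw [show -ν * j + (1 - ν) = 1 - ν * (j + 1) by ring, ← hankelIntegral_exp hL hθ₁ hθ₂]
    refine integral_congr_ae (.of_forall fun s => ?_)
    simp only [φ, p, ← Complex.exp_nat_mul, mul_assoc]
    push_cast
    ring_nf
  have hB : ∀ n : ℕ, ∫ s, φ s * (p s ^ n)⁻¹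
      = 2 * π * Complex.I * ((Real.Gamma (ν * n + 1))⁻¹ : ℝ) := by
    intro n
    rw [show ν * n + 1 = 1 - (-ν * n) by ring, ← hankelIntegral_exp hL hθ₁ hθ₂]
    refine integral_congr_ae (.of_forall fun s => ?_)
    simp only [φ, p, ← Complex.exp_nat_mul, ← Complex.exp_neg, mul_assoc]
    push_cast
    ring_nf
  have hwright : ∀ x : ℝ, ∫ s, φ s * p s * Complex.exp (-x * p s)
      = 2 * π * Complex.I * (wright (-ν) (1 - ν) (-x) : ℝ) := by
    intro x
    rw [← (hasSum_integral_exp_series hφm hpm hint x).tsum_eq, wright, Complex.ofReal_tsum,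
      ← tsum_mul_left]
    refine tsum_congr fun j => ?_
    rw [hA]
    push_cast
    field_simp
  have hML : ∫ s, φ s * p s / (μ + p s) = 2 * π * Complex.I * (mittagLeffler ν 1 (-μ) : ℝ) := by
    rw [← (hasSum_integral_inv_pow hφi hpm hμ (lt_add_one μ) hρ).tsum_eq, mittagLeffler,
      Complex.ofReal_tsum, ← tsum_mul_left]
    refine tsum_congr fun n => ?_
    rw [hB]
    push_cast
    field_simp
  have hmain := integral_exp_mul_integral hφm hpm hint hre hμ
  simp_rw [hwright, hML, mul_left_comm _ (2 * (π : ℂ) * Complex.I), integral_const_mul] at hmain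
  have hmain' := mul_left_cancel₀ Complex.two_pi_I_ne_zero hmain
  rw [← Complex.ofReal_inj, ← hmain', ← integral_complex_ofReal]
  refine integral_congr_ae (.of_forall fun x => ?_)
  push_cast
  rfl

theorem wright_laplace_eq_mittagLeffler (ν lam : ℝ) (hν : ν ∈ Set.Ioo (0:ℝ) 1)
    (hlam : 0 < lam) :
    ∀ t > (0:ℝ),
      (1 / t ^ ν) * ∫ z in Set.Ioi (0:ℝ),
          Real.exp (-lam * z) * wright (-ν) (1 - ν) (-(z / t ^ ν)) =
        mittagLeffler ν 1 (-(lam * t ^ ν)) := by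
  intro t ht
  have hT : 0 < t ^ ν := Real.rpow_pos_of_pos ht ν
  rw [← integral_exp_mul_wright hν (mul_pos hlam hT)]
  have h := integral_comp_mul_left_Ioi
    (fun x => Real.exp (-(lam * t ^ ν) * x) * wright (-ν) (1 - ν) (-x)) 0 (inv_pos.2 hT)
  rw [mul_zero, inv_inv, smul_eq_mul] at h
  rw [one_div, inv_mul_eq_iff_eq_mul₀ hT.ne', ← h]
  refine integral_congr_ae (.of_forall fun z => ?_)
  have e1 : -(lam * t ^ ν) * ((t ^ ν)⁻¹ * z) = -lam * z := by field_simp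
  simp only [e1, div_eq_inv_mul]
end

section
/- For every λ > 0 and t > 0, (1/√(π t)) ∫_0^∞ e^{−λ y} e^{−y²/(4t)} dy = Σ_{j=0}^∞ (−λ√t)^j / Γ(j/2 + 1) = E_{1/2,1}(−λ√t); that is, the crossing probability Pr{|B(t)| < U} of an exponential boundary U by a Brownian motion B with variance 2t equals the Mittag-Leffler function E_{1/2,1}(−λ√t), the solution of the fractional relaxation equation of order 1/2. -/
open Real MeasureTheory Set

/-- The `n`-th moment over the half line of the Gaussian weight `exp (-y² / (4t))`. -/
theorem integral_pow_mul_exp_neg_sq_div {t : ℝ} (ht : 0 < t) (n : ℕ) :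
    ∫ y in Ioi (0:ℝ), y ^ n * Real.exp (-(y ^ 2) / (4 * t)) =
      Real.sqrt t ^ n * Real.sqrt t * 2 ^ n * Real.Gamma ((n + 1) / 2) := by
  have h := integral_rpow_mul_exp_neg_mul_rpow (p := 2) (q := n) (b := 1 / (4 * t))
    (by norm_num) (by linarith [Nat.cast_nonneg (α := ℝ) n]) (by positivity)
  have hroot : (1 / (4 * t)) ^ (-((n : ℝ) + 1) / 2) = (2 * Real.sqrt t) ^ (n + 1) := by
    have hsq : 1 / (4 * t) = (2 * Real.sqrt t) ^ (-2 : ℝ) := by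
      rw [Real.rpow_neg (by positivity), Real.rpow_two, mul_pow, Real.sq_sqrt ht.le]
      norm_num
    rw [hsq, ← Real.rpow_mul (by positivity), ← Real.rpow_natCast]
    congr 1
    push_cast
    ring
  rw [hroot] at h
  calc _ = ∫ y in Ioi (0:ℝ), y ^ (n : ℝ) * Real.exp (-(1 / (4 * t)) * y ^ (2 : ℝ)) := by
        refine setIntegral_congr_fun measurableSet_Ioi fun y _ => ?_
        simp only [Real.rpow_natCast, Real.rpow_two]
        congr 2
        ring
    _ = _ := by
        rw [h]
        ring

/-- Legendre duplication at the half integer `(n + 1) / 2`. -/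
theorem Gamma_half_mul_Gamma_half_add_one (n : ℕ) :
    2 ^ n * Real.Gamma ((n + 1) / 2) * Real.Gamma (n / 2 + 1) =
      (Nat.factorial n : ℝ) * Real.sqrt Real.pi := by
  have h := Real.Gamma_mul_Gamma_add_half ((n + 1) / 2)
  rw [show ((n : ℝ) + 1) / 2 + 1 / 2 = n / 2 + 1 by ring,
    show 2 * (((n : ℝ) + 1) / 2) = n + 1 by ring, Real.Gamma_nat_eq_factorial,
    show 1 - ((n : ℝ) + 1) = -n by ring, Real.rpow_neg two_pos.le, Real.rpow_natCast] at h
  rw [mul_assoc, h]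
  field_simp

theorem integrable_exp_mul_mul_exp_neg_sq_div {t : ℝ} (ht : 0 < t) (c : ℝ) :
    Integrable fun y : ℝ => Real.exp (c * y) * Real.exp (-(y ^ 2) / (4 * t)) := by
  refine ((integrable_exp_neg_mul_sq (b := 1 / (8 * t)) (by positivity)).const_mul
    (Real.exp (2 * t * c ^ 2))).mono' (by fun_prop) (.of_forall fun y => ?_)
  rw [Real.norm_of_nonneg (by positivity), ← Real.exp_add, ← Real.exp_add, Real.exp_le_exp]
  have hsq : 2 * t * c ^ 2 + -(1 / (8 * t)) * y ^ 2 - (c * y + -(y ^ 2) / (4 * t)) =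
      (4 * t * c - y) ^ 2 / (8 * t) := by
    field_simp
    ring
  have : 0 ≤ (4 * t * c - y) ^ 2 / (8 * t) := by positivity
  linarith

theorem hasSum_integral_exp_mul_mul_exp_neg_sq_div {t : ℝ} (ht : 0 < t) (c : ℝ) :
    HasSum (fun n : ℕ => ∫ y in Ioi (0:ℝ),
        (c * y) ^ n / (Nat.factorial n : ℝ) * Real.exp (-(y ^ 2) / (4 * t)))
      (∫ y in Ioi (0:ℝ), Real.exp (c * y) * Real.exp (-(y ^ 2) / (4 * t))) := by
  have hexp (x : ℝ) : HasSum (fun n : ℕ => x ^ n / (Nat.factorial n : ℝ)) (Real.exp x) := by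
    rw [Real.exp_eq_exp_ℝ]
    exact NormedSpace.expSeries_div_hasSum_exp x
  have hbound (y : ℝ) := (hexp (|c| * y)).mul_right (Real.exp (-(y ^ 2) / (4 * t)))
  refine hasSum_integral_of_dominated_convergence
    (fun n y => (|c| * y) ^ n / (Nat.factorial n : ℝ) * Real.exp (-(y ^ 2) / (4 * t)))
    (fun n => by fun_prop) (fun n => ?_) (.of_forall fun y => (hbound y).summable) ?_
    (.of_forall fun y => (hexp (c * y)).mul_right _)
  · filter_upwards [ae_restrict_mem measurableSet_Ioi] with y hy
    rw [norm_mul, norm_div, norm_pow, norm_mul, Real.norm_eq_abs c,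
      Real.norm_of_nonneg (le_of_lt hy), Real.norm_of_nonneg (Real.exp_pos _).le,
      Real.norm_of_nonneg (Nat.cast_nonneg _)]
  · simp only [fun y => (hbound y).tsum_eq]
    exact (integrable_exp_mul_mul_exp_neg_sq_div ht |c|).integrableOn

theorem brownian_exponential_crossing (lam : ℝ) (hlam : 0 < lam) :
    ∀ t > (0:ℝ),
      ((1 / Real.sqrt (Real.pi * t)) * ∫ y in Set.Ioi (0:ℝ),
          Real.exp (-lam * y) * Real.exp (-(y ^ 2) / (4 * t))) =
        (∑' j : ℕ, (-(lam * Real.sqrt t)) ^ j / Real.Gamma (j / 2 + 1)) ∧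
      (∑' j : ℕ, (-(lam * Real.sqrt t)) ^ j / Real.Gamma (j / 2 + 1)) =
        mittagLeffler (1/2) 1 (-(lam * Real.sqrt t)) := by
  intro t ht
  constructor
  · rw [← ((hasSum_integral_exp_mul_mul_exp_neg_sq_div ht (-lam)).mul_left _).tsum_eq]
    refine tsum_congr fun n => ?_
    have hterm : ∫ y in Ioi (0:ℝ),
        (-lam * y) ^ n / (Nat.factorial n : ℝ) * Real.exp (-(y ^ 2) / (4 * t)) =
        (-lam) ^ n / (Nat.factorial n : ℝ) *
          (Real.sqrt t ^ n * Real.sqrt t * 2 ^ n * Real.Gamma ((n + 1) / 2)) := by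
      rw [← integral_pow_mul_exp_neg_sq_div ht, ← integral_const_mul]
      congr 1 with y
      rw [mul_pow]
      ring
    have hdup := Gamma_half_mul_Gamma_half_add_one n
    have hΓ : 0 < Real.Gamma ((n : ℝ) / 2 + 1) := Real.Gamma_pos_of_pos (by positivity)
    have hst : 0 < Real.sqrt t := Real.sqrt_pos.2 ht
    have hsπ : 0 < Real.sqrt Real.pi := Real.sqrt_pos.2 Real.pi_pos
    have hfac : (0:ℝ) < Nat.factorial n := by positivity
    rw [hterm, Real.sqrt_mul Real.pi_pos.le, ← neg_mul, mul_pow, eq_div_iff hΓ.ne']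
    calc _ = (-lam) ^ n * Real.sqrt t ^ n * (Real.sqrt t / Real.sqrt t) *
          ((2 ^ n * Real.Gamma ((n + 1) / 2) * Real.Gamma (n / 2 + 1)) /
            ((Nat.factorial n : ℝ) * Real.sqrt Real.pi)) := by
          field_simp
      _ = _ := by
          rw [hdup, div_self hst.ne', div_self (by positivity), mul_one, mul_one]
  · refine tsum_congr fun n => ?_
    rw [one_div_mul_eq_div]
end

section
/- For every x > 0, Σ_{j=0}^∞ (−x)^j / Γ(j/2 + 1) = (1/√π) ∫_0^∞ e^{−z} z^{−1/2} e^{−2x√z} dz; that is, the Mittag-Leffler function E_{1/2,1}(−x) admits this integral representation. -/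
open Real MeasureTheory Set

/-- Legendre's duplication formula at half-integers. -/
lemma Gamma_half_nat_mul (j : ℕ) :
    Real.Gamma ((j + 1) / 2) * Real.Gamma (j / 2 + 1) = j.factorial * √π / 2 ^ j := by
  have h := Real.Gamma_mul_Gamma_add_half ((j + 1) / 2 : ℝ)
  rw [show (j + 1) / 2 + 1 / 2 = (j / 2 + 1 : ℝ) by ring,
    show 2 * ((j + 1) / 2) = (j + 1 : ℝ) by ring, Real.Gamma_nat_eq_factorial,
    show 1 - (j + 1 : ℝ) = -(j : ℝ) by ring, Real.rpow_neg zero_le_two, Real.rpow_natCast] at h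
  rw [h]
  ring

lemma integral_exp_neg_mul_rpow_mul_sqrt_pow (a : ℝ) (j : ℕ) :
    ∫ z in Ioi (0 : ℝ), Real.exp (-z) * z ^ (-(1 : ℝ) / 2) * ((a * √z) ^ j / j.factorial) =
      a ^ j / j.factorial * Real.Gamma ((j + 1) / 2) := by
  rw [Real.Gamma_eq_integral (by positivity), ← integral_const_mul]
  refine setIntegral_congr_fun measurableSet_Ioi fun z hz ↦ ?_
  have hz : 0 < z := hz
  have h : z ^ ((j + 1 : ℝ) / 2 - 1) = z ^ (-(1 : ℝ) / 2) * √z ^ j := by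
    rw [Real.sqrt_eq_rpow, ← Real.rpow_natCast, ← Real.rpow_mul hz.le, ← Real.rpow_add hz]
    ring_nf
  simp only [h, mul_pow]
  ring

lemma integrableOn_exp_neg_mul_rpow_mul_exp_sqrt (a : ℝ) :
    IntegrableOn (fun z : ℝ ↦ Real.exp (-z) * z ^ (-(1 : ℝ) / 2) * Real.exp (a * √z))
      (Ioi 0) := by
  have h := (integrableOn_rpow_mul_exp_neg_mul_rpow (s := -(1 : ℝ) / 2) (p := 1) (b := 1 / 2)
    (by norm_num) one_pos (by norm_num)).const_mul (Real.exp (a ^ 2 / 2))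
  refine h.mono' (by fun_prop) ?_
  filter_upwards [ae_restrict_mem measurableSet_Ioi] with z hz
  have hz : 0 < z := hz
  rw [Real.norm_of_nonneg (by positivity), Real.rpow_one]
  calc Real.exp (-z) * z ^ (-(1 : ℝ) / 2) * Real.exp (a * √z)
      = z ^ (-(1 : ℝ) / 2) * Real.exp (-z + a * √z) := by rw [Real.exp_add]; ring
    _ ≤ z ^ (-(1 : ℝ) / 2) * Real.exp (a ^ 2 / 2 + -(1 / 2) * z) := by
        gcongr z ^ (-(1 : ℝ) / 2) * Real.exp ?_
        nlinarith [sq_nonneg (a - √z), Real.sq_sqrt hz.le]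
    _ = _ := by rw [Real.exp_add]; ring

lemma hasSum_integral_exp_neg_mul_rpow_mul_exp_sqrt (a : ℝ) :
    HasSum (fun j : ℕ ↦ a ^ j / j.factorial * Real.Gamma ((j + 1) / 2))
      (∫ z in Ioi (0 : ℝ), Real.exp (-z) * z ^ (-(1 : ℝ) / 2) * Real.exp (a * √z)) := by
  have hexp (y : ℝ) : HasSum (fun j : ℕ ↦ y ^ j / j.factorial) (Real.exp y) := by
    simpa [Real.exp_eq_exp_ℝ] using NormedSpace.expSeries_div_hasSum_exp y
  simp_rw [← integral_exp_neg_mul_rpow_mul_sqrt_pow]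
  refine hasSum_integral_of_dominated_convergence
    (fun j z ↦ Real.exp (-z) * z ^ (-(1 : ℝ) / 2) * ((|a| * √z) ^ j / j.factorial))
    (fun j ↦ by fun_prop) (fun j ↦ ?_) (.of_forall fun z ↦ ((hexp _).mul_left _).summable) ?_
    (.of_forall fun z ↦ (hexp _).mul_left _)
  · filter_upwards [ae_restrict_mem measurableSet_Ioi] with z hz
    have hz : 0 < z := hz
    simp [abs_of_pos (Real.rpow_pos_of_pos hz _), abs_of_nonneg (Real.sqrt_nonneg z)]
  · simp_rw [fun z : ℝ ↦ ((hexp (|a| * √z)).mul_left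
      (Real.exp (-z) * z ^ (-(1 : ℝ) / 2))).tsum_eq]
    exact integrableOn_exp_neg_mul_rpow_mul_exp_sqrt |a|

theorem mittagLeffler_half_integral_rep :
    ∀ x > (0:ℝ),
      (∑' j : ℕ, (-x) ^ j / Real.Gamma (j / 2 + 1)) =
        (1 / Real.sqrt Real.pi) * ∫ z in Set.Ioi (0:ℝ),
          Real.exp (-z) * z ^ (-(1:ℝ)/2) * Real.exp (-2 * x * Real.sqrt z) := by
  intro x _
  rw [← (hasSum_integral_exp_neg_mul_rpow_mul_exp_sqrt (-2 * x)).tsum_eq, ← tsum_mul_left]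
  refine tsum_congr fun j ↦ ?_
  have hG : Real.Gamma ((j : ℝ) / 2 + 1) ≠ 0 := (Real.Gamma_pos_of_pos (by positivity)).ne'
  have hpi : √π ≠ 0 := by positivity
  rw [eq_div_of_mul_eq hG (Gamma_half_nat_mul j), show -2 * x = 2 * -x by ring, mul_pow]
  field_simp
end

section
/- For every λ > 0 and t > 0, ∫_0^t e^{−λ s} / (π √(s(t−s))) ds = e^{−λ t/2} · Σ_{k=0}^∞ (λ t/4)^{2k} / (k!)²; that is, the crossing probability ψ⁺(t) = Pr{Γ_t⁺ < U} of an exponential boundary U by the Brownian sojourn time Γ_t⁺ equals e^{−λt/2} I₀(λt/2), where I₀ is the modified Bessel function of order 0. -/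
open Real MeasureTheory Set

theorem integral_cos_pow_odd (k : ℕ) : ∫ θ in (0:ℝ)..π, cos θ ^ (2 * k + 1) = 0 := by
  induction k with
  | zero => simp
  | succ k ih =>
    rw [show 2 * (k + 1) + 1 = (2 * k + 1) + 2 by ring, integral_cos_pow, ih]
    simp

theorem integral_cos_pow_even (k : ℕ) :
    ∫ θ in (0:ℝ)..π, cos θ ^ (2 * k) =
      π * (Nat.factorial (2 * k) : ℝ) / (4 ^ k * (Nat.factorial k : ℝ) ^ 2) := by
  induction k with
  | zero => simp
  | succ k ih =>
    have hk : (Nat.factorial k : ℝ) ≠ 0 := by positivity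
    rw [show 2 * (k + 1) = 2 * k + 2 by ring, integral_cos_pow, ih, Nat.factorial_succ (2 * k + 1),
      Nat.factorial_succ (2 * k), Nat.factorial_succ k]
    push_cast
    simp only [sin_pi, sin_zero]
    field_simp
    ring

/-- Integral representation of the modified Bessel function of order `0`. -/
theorem hasSum_integral_exp_mul_cos (x : ℝ) :
    HasSum (fun k : ℕ => (x / 2) ^ (2 * k) / (Nat.factorial k : ℝ) ^ 2)
      (π⁻¹ * ∫ θ in (0:ℝ)..π, exp (x * cos θ)) := by
  have hseries (y : ℝ) : HasSum (fun n : ℕ => y ^ n / (Nat.factorial n : ℝ)) (exp y) := by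
    rw [Real.exp_eq_exp_ℝ]
    exact NormedSpace.expSeries_div_hasSum_exp y
  have hint : HasSum (fun n : ℕ => ∫ θ in (0:ℝ)..π, (x * cos θ) ^ n / (Nat.factorial n : ℝ))
      (∫ θ in (0:ℝ)..π, exp (x * cos θ)) := by
    refine intervalIntegral.hasSum_integral_of_dominated_convergence
      (fun n _ => |x| ^ n / (Nat.factorial n : ℝ)) (fun n => ?_) (fun n => ?_) ?_ ?_ ?_
    · exact (by fun_prop : Continuous fun θ => (x * cos θ) ^ n / (Nat.factorial n : ℝ))
        |>.aestronglyMeasurable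
    · refine ae_of_all _ fun θ _ => ?_
      rw [norm_div, norm_pow, norm_mul, Real.norm_eq_abs, Real.norm_eq_abs, Real.norm_natCast]
      gcongr
      exact mul_le_of_le_one_right (abs_nonneg x) (abs_cos_le_one θ)
    · exact ae_of_all _ fun _ _ => (hseries |x|).summable
    · simp
    · exact ae_of_all _ fun θ _ => hseries (x * cos θ)
  have heven := (Function.Injective.hasSum_iff (mul_right_injective₀ (two_ne_zero (α := ℕ)))
    (fun n hn => by
      obtain ⟨k, rfl | rfl⟩ := Nat.even_or_odd' n
      · exact absurd ⟨k, rfl⟩ hn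
      · simp_rw [mul_pow, mul_div_right_comm]
        rw [intervalIntegral.integral_const_mul, integral_cos_pow_odd, mul_zero])).mpr hint
  refine (heven.mul_left π⁻¹).congr_fun fun k => ?_
  simp only [Function.comp_apply, mul_pow, mul_div_right_comm _ (cos _ ^ _)]
  rw [intervalIntegral.integral_const_mul, integral_cos_pow_even, div_pow, pow_mul 2 2 k]
  have := pi_ne_zero
  field_simp
  norm_num

/-- Change of variables `s = t (1 - cos θ) / 2` against the arcsine density on `(0, t)`. -/
theorem integral_div_pi_mul_sqrt_mul_sub (g : ℝ → ℝ) {t : ℝ} (ht : 0 < t) :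
    ∫ s in (0:ℝ)..t, g s / (π * √(s * (t - s))) =
      π⁻¹ * ∫ θ in (0:ℝ)..π, g (t / 2 * (1 - cos θ)) := by
  have himage : (fun θ => t / 2 * (1 - cos θ)) '' Icc 0 π = Icc 0 t := by
    rw [← Function.comp_def (fun y => t / 2 * (1 - y)) cos, image_comp, bijOn_cos.image_eq]
    ext s
    constructor
    · rintro ⟨y, ⟨h₁, h₂⟩, rfl⟩
      constructor <;> dsimp only <;> nlinarith
    · rintro ⟨h₁, h₂⟩
      refine ⟨1 - 2 * s / t, ⟨?_, ?_⟩, ?_⟩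
      · have : s / t ≤ 1 := (div_le_one ht).mpr h₂
        linarith [mul_div_assoc 2 s t]
      · have : 0 ≤ 2 * s / t := by positivity
        linarith
      · field_simp
        ring
  have hinj : InjOn (fun θ => t / 2 * (1 - cos θ)) (Icc 0 π) := fun a ha b hb hab =>
    injOn_cos ha hb (by simpa [ht.ne'] using hab)
  have hderiv (θ : ℝ) : HasDerivAt (fun θ => t / 2 * (1 - cos θ)) (t / 2 * sin θ) θ := by
    simpa using ((hasDerivAt_cos θ).const_sub 1).const_mul (t / 2)
  rw [intervalIntegral.integral_of_le ht.le, intervalIntegral.integral_of_le pi_pos.le,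
    ← integral_Icc_eq_integral_Ioc, ← himage,
    integral_image_eq_integral_abs_deriv_smul measurableSet_Icc
      (fun θ _ => (hderiv θ).hasDerivWithinAt) hinj,
    integral_Icc_eq_integral_Ioo, integral_Ioc_eq_integral_Ioo, ← integral_const_mul]
  refine setIntegral_congr_fun measurableSet_Ioo fun θ hθ => ?_
  have hsin : 0 < sin θ := sin_pos_of_mem_Ioo hθ
  have hsqrt : √(t / 2 * (1 - cos θ) * (t - t / 2 * (1 - cos θ))) = t / 2 * sin θ := by
    rw [← sqrt_sq (by positivity : 0 ≤ t / 2 * sin θ)]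
    congr 1
    rw [mul_pow, sin_sq]
    ring
  rw [hsqrt, abs_of_pos (by positivity), smul_eq_mul]
  field_simp

theorem sojourn_exponential_crossing (lam : ℝ) (hlam : 0 < lam) :
    ∀ t > (0:ℝ),
      (∫ s in (0:ℝ)..t, Real.exp (-lam * s) / (Real.pi * Real.sqrt (s * (t - s)))) =
        Real.exp (-lam * t / 2) *
          ∑' k : ℕ, (lam * t / 4) ^ (2 * k) / ((Nat.factorial k : ℝ)) ^ 2 := by
  intro t ht
  rw [integral_div_pi_mul_sqrt_mul_sub (fun s => exp (-lam * s)) ht]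
  have hexp (θ : ℝ) : exp (-lam * (t / 2 * (1 - cos θ))) =
      exp (-lam * t / 2) * exp (lam * t / 2 * cos θ) := by
    rw [← exp_add]
    ring_nf
  simp_rw [hexp]
  rw [intervalIntegral.integral_const_mul, mul_left_comm,
    ← (hasSum_integral_exp_mul_cos (lam * t / 2)).tsum_eq]
  ring_nf
end

section
/- For every α, λ > 0 and every η > 0, the Laplace transform of the elastic Brownian crossing probability satisfies ∫_0^∞ e^{−η t} ψ^el_α(t) dt = (α λ η^{−1} + √2 · α η^{−1/2} + 2) / ((√(2η) + α)(√(2η) + λ)). -/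
open Real MeasureTheory Set

/-- Crossing probability of an exponential boundary of rate `lam` by the elastic
Brownian motion with absorbing rate `α`. -/
noncomputable def psiEl (α lam t : ℝ) : ℝ :=
  2 * (∫ s in Set.Ioi (0:ℝ), Real.exp (-(lam - α) * s) *
      ∫ w in Set.Ioi s, w * Real.exp (-α * w) * Real.exp (-(w ^ 2) / (2 * t)) /
        Real.sqrt (2 * Real.pi * t ^ 3)) +
    1 - 2 * Real.exp (α ^ 2 * t / 2) *
      ∫ w in Set.Ioi (α * Real.sqrt t), Real.exp (-(w ^ 2) / 2) / Real.sqrt (2 * Real.pi)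

open Filter Topology

theorem integrableOn_and_integral_Ioi_of_hasDerivAt_of_nonneg {f f' : ℝ → ℝ} {a b x₀ : ℝ}
    (hderiv : ∀ x ∈ Ioi x₀, HasDerivAt f (f' x) x) (hpos : ∀ x ∈ Ioi x₀, 0 ≤ f' x)
    (ha : Tendsto f (𝓝[>] x₀) (𝓝 a)) (hb : Tendsto f atTop (𝓝 b)) :
    IntegrableOn f' (Ioi x₀) ∧ ∫ x in Ioi x₀, f' x = b - a := by
  set g : ℝ → ℝ := Function.update f x₀ a with hg
  have hcont : ContinuousWithinAt g (Ici x₀) x₀ := by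
    rw [hg, continuousWithinAt_update_same, Ici_sdiff_left]
    exact ha
  have hd : ∀ x ∈ Ioi x₀, HasDerivAt g (f' x) x := fun x hx =>
    (hderiv x hx).congr_of_eventuallyEq <| by
      filter_upwards [isOpen_Ioi.mem_nhds hx] with y hy
      exact Function.update_of_ne (ne_of_gt hy) _ _
  have ht : Tendsto g atTop (𝓝 b) := hb.congr' <| by
    filter_upwards [eventually_gt_atTop x₀] with y hy
    exact (Function.update_of_ne (ne_of_gt hy) _ _).symm
  refine ⟨integrableOn_Ioi_deriv_of_nonneg hcont hd hpos ht, ?_⟩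
  rw [integral_Ioi_of_hasDerivAt_of_nonneg hcont hd hpos ht, hg, Function.update_self]

theorem setIntegral_Ioi_eq_comp_affine (g : ℝ → ℝ) (a : ℝ) {c : ℝ} (hc : 0 < c) :
    ∫ x in Ioi a, g x = c * ∫ x in Ioi (0 : ℝ), g (a + c * x) := by
  rw [integral_comp_mul_left_Ioi (fun y => g (a + y)) 0 hc, mul_zero, smul_eq_mul,
    mul_inv_cancel_left₀ hc.ne', ← integral_indicator measurableSet_Ioi,
    ← integral_indicator measurableSet_Ioi, ← integral_add_left_eq_self _ a]
  congr 1 with x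
  simp [indicator, mem_Ioi]

/-- The primitive of `exp (-y² / 2)` vanishing at the origin. -/
noncomputable def gaussPrimitive (x : ℝ) : ℝ := ∫ y in (0 : ℝ)..x, Real.exp (-(y ^ 2) / 2)

theorem hasDerivAt_gaussPrimitive (x : ℝ) :
    HasDerivAt gaussPrimitive (Real.exp (-(x ^ 2) / 2)) x :=
  (by fun_prop : Continuous fun y : ℝ => Real.exp (-(y ^ 2) / 2)).integral_hasStrictDerivAt 0 x
    |>.hasDerivAt

theorem gaussPrimitive_neg (x : ℝ) : gaussPrimitive (-x) = -gaussPrimitive x := by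
  have h := intervalIntegral.integral_comp_neg (a := 0) (b := x)
    (fun y : ℝ => Real.exp (-(y ^ 2) / 2))
  simp only [even_two, Even.neg_pow, neg_zero] at h
  rw [gaussPrimitive, gaussPrimitive, h, ← intervalIntegral.integral_symm]

theorem tendsto_gaussPrimitive_atTop :
    Tendsto gaussPrimitive atTop (𝓝 (√(2 * π) / 2)) := by
  have h1 : ∀ y : ℝ, Real.exp (-(y ^ 2) / 2) = Real.exp (-(1 / 2) * y ^ 2) := fun y => by
    congr 1; ring
  have h2 : ∫ y in Ioi (0 : ℝ), Real.exp (-(y ^ 2) / 2) = √(2 * π) / 2 := by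
    simp_rw [h1]
    rw [integral_gaussian_Ioi]
    congr 2; ring
  rw [← h2]
  refine intervalIntegral_tendsto_integral_Ioi 0 ?_ tendsto_id
  simp_rw [h1]
  exact (integrable_exp_neg_mul_sq (by norm_num)).integrableOn

theorem tendsto_gaussPrimitive_atBot :
    Tendsto gaussPrimitive atBot (𝓝 (-(√(2 * π) / 2))) := by
  refine (tendsto_gaussPrimitive_atTop.comp tendsto_neg_atBot_atTop).neg.congr fun x => ?_
  simp [gaussPrimitive_neg]

theorem hasDerivAt_gaussPrimitive_comp {η w c t : ℝ} (hc : c ^ 2 = 2 * η) (ht : 0 < t) :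
    HasDerivAt (fun t => -Real.exp (w * c) * gaussPrimitive (w / √t + c * √t))
      (Real.exp (-η * t) * Real.exp (-(w ^ 2) / (2 * t)) * ((w / (t * √t) - c / √t) / 2)) t := by
  have hs : 0 < √t := Real.sqrt_pos.2 ht
  have hsq : √t ^ 2 = t := Real.sq_sqrt ht.le
  have h1 := Real.hasDerivAt_sqrt ht.ne'
  have h2 := ((hasDerivAt_const t w).fun_div h1 hs.ne').fun_add (h1.const_mul c)
  refine (((hasDerivAt_gaussPrimitive _).comp t h2).const_mul (-Real.exp (w * c))).congr_deriv ?_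
  have h3 : Real.exp (-((w / √t + c * √t) ^ 2) / 2) =
      Real.exp (-η * t) * Real.exp (-(w ^ 2) / (2 * t)) * Real.exp (-(w * c)) := by
    rw [← Real.exp_add, ← Real.exp_add]
    congr 1
    have : (w / √t + c * √t) ^ 2 = w ^ 2 / √t ^ 2 + 2 * (w * c) + c ^ 2 * √t ^ 2 := by
      field_simp
      ring
    rw [this, hsq, hc]
    field_simp
    ring
  rw [h3, hsq]
  have h4 : Real.exp (w * c) * Real.exp (-(w * c)) = 1 := by
    rw [← Real.exp_add, add_neg_cancel, Real.exp_zero]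
  linear_combination
    (-(Real.exp (-η * t) * Real.exp (-(w ^ 2) / (2 * t))) *
      ((0 * √t - w * (1 / (2 * √t))) / t + c * (1 / (2 * √t)))) * h4

theorem tendsto_sqrt_nhdsGT_zero : Tendsto (fun t : ℝ => √t) (𝓝[>] 0) (𝓝[>] 0) := by
  refine tendsto_nhdsWithin_iff.2 ⟨?_, ?_⟩
  · simpa using (Real.continuous_sqrt.tendsto 0).mono_left nhdsWithin_le_nhds
  · filter_upwards [self_mem_nhdsWithin] with t ht using Real.sqrt_pos.2 ht

theorem tendsto_gaussPrimitive_comp_nhdsGT_zero {w : ℝ} (c : ℝ) (hw : 0 < w) :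
    Tendsto (fun t => -Real.exp (w * c) * gaussPrimitive (w / √t + c * √t)) (𝓝[>] 0)
      (𝓝 (-Real.exp (w * c) * (√(2 * π) / 2))) := by
  refine (tendsto_gaussPrimitive_atTop.comp ?_).const_mul _
  refine Tendsto.atTop_add (C := c * 0) ?_ ?_
  · simp_rw [div_eq_mul_inv]
    exact (tendsto_inv_nhdsGT_zero.comp tendsto_sqrt_nhdsGT_zero).const_mul_atTop hw
  · exact (tendsto_nhdsWithin_iff.1 tendsto_sqrt_nhdsGT_zero).1.const_mul _

theorem tendsto_div_sqrt_atTop (w : ℝ) : Tendsto (fun t => w / √t) atTop (𝓝 0) :=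
  tendsto_const_nhds.div_atTop Real.tendsto_sqrt_atTop

theorem tendsto_gaussPrimitive_comp_atTop_of_pos (w : ℝ) {c : ℝ} (hc : 0 < c) :
    Tendsto (fun t => -Real.exp (w * c) * gaussPrimitive (w / √t + c * √t)) atTop
      (𝓝 (-Real.exp (w * c) * (√(2 * π) / 2))) :=
  (tendsto_gaussPrimitive_atTop.comp <| (tendsto_div_sqrt_atTop w).add_atTop
    (Real.tendsto_sqrt_atTop.const_mul_atTop hc)).const_mul _

theorem tendsto_gaussPrimitive_comp_atTop_of_neg (w : ℝ) {c : ℝ} (hc : c < 0) :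
    Tendsto (fun t => -Real.exp (w * c) * gaussPrimitive (w / √t + c * √t)) atTop
      (𝓝 (-Real.exp (w * c) * -(√(2 * π) / 2))) :=
  (tendsto_gaussPrimitive_atBot.comp <| (tendsto_div_sqrt_atTop w).add_atBot
    (Real.tendsto_sqrt_atTop.const_mul_atTop_of_neg hc)).const_mul _

/-- Laplace transform of the first passage density of Brownian motion at level `w`. -/
theorem laplace_firstPassage {η w : ℝ} (hη : 0 < η) (hw : 0 < w) :
    IntegrableOn (fun t => Real.exp (-η * t) *
      (w * Real.exp (-(w ^ 2) / (2 * t)) / √(2 * π * t ^ 3))) (Ioi 0) ∧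
    ∫ t in Ioi (0 : ℝ), Real.exp (-η * t) *
      (w * Real.exp (-(w ^ 2) / (2 * t)) / √(2 * π * t ^ 3)) = Real.exp (-√(2 * η) * w) := by
  have hm : 0 < √(2 * η) := by positivity
  have hm2 : √(2 * η) ^ 2 = 2 * η := Real.sq_sqrt (by positivity)
  have hpi : 0 < √(2 * π) := by positivity
  have key := integrableOn_and_integral_Ioi_of_hasDerivAt_of_nonneg (x₀ := 0)
    (f' := fun t => Real.exp (-η * t) *
      (w * Real.exp (-(w ^ 2) / (2 * t)) / √(2 * π * t ^ 3)))
    (fun t ht => (((hasDerivAt_gaussPrimitive_comp (w := w) hm2 ht).add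
      (hasDerivAt_gaussPrimitive_comp (w := w) ((neg_sq √(2 * η)).trans hm2) ht)).div_const
        √(2 * π)).congr_deriv ?_) (fun t ht => by positivity)
    (((tendsto_gaussPrimitive_comp_nhdsGT_zero _ hw).add
      (tendsto_gaussPrimitive_comp_nhdsGT_zero _ hw)).div_const _)
    (((tendsto_gaussPrimitive_comp_atTop_of_pos w hm).add
      (tendsto_gaussPrimitive_comp_atTop_of_neg w (neg_neg_of_pos hm))).div_const _)
  · refine ⟨key.1, key.2.trans ?_⟩
    rw [mul_neg, neg_mul, mul_comm w]
    field_simp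
    ring
  · have ht : 0 < t := ht
    have hs : 0 < √t := Real.sqrt_pos.2 ht
    have : √(2 * π * t ^ 3) = √(2 * π) * (t * √t) := by
      rw [Real.sqrt_mul (by positivity) (t ^ 3), pow_succ, Real.sqrt_mul (sq_nonneg t),
        Real.sqrt_sq ht.le]
    rw [this]
    field_simp
    ring

/-- Laplace transform of the centred Gaussian density of variance `t` at `w`. -/
theorem laplace_heatKernel {η w : ℝ} (hη : 0 < η) (hw : 0 < w) :
    IntegrableOn (fun t => Real.exp (-η * t) *
      (Real.exp (-(w ^ 2) / (2 * t)) / √(2 * π * t))) (Ioi 0) ∧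
    ∫ t in Ioi (0 : ℝ), Real.exp (-η * t) *
      (Real.exp (-(w ^ 2) / (2 * t)) / √(2 * π * t)) =
        Real.exp (-√(2 * η) * w) / √(2 * η) := by
  have hm : 0 < √(2 * η) := by positivity
  have hm2 : √(2 * η) ^ 2 = 2 * η := Real.sq_sqrt (by positivity)
  have hpi : 0 < √(2 * π) := by positivity
  have key := integrableOn_and_integral_Ioi_of_hasDerivAt_of_nonneg (x₀ := 0)
    (f' := fun t => Real.exp (-η * t) * (Real.exp (-(w ^ 2) / (2 * t)) / √(2 * π * t)))
    (fun t ht => (((hasDerivAt_gaussPrimitive_comp (w := w) ((neg_sq √(2 * η)).trans hm2) ht).sub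
      (hasDerivAt_gaussPrimitive_comp (w := w) hm2 ht)).div_const
        (√(2 * η) * √(2 * π))).congr_deriv ?_) (fun t ht => by positivity)
    (((tendsto_gaussPrimitive_comp_nhdsGT_zero _ hw).sub
      (tendsto_gaussPrimitive_comp_nhdsGT_zero _ hw)).div_const _)
    (((tendsto_gaussPrimitive_comp_atTop_of_neg w (neg_neg_of_pos hm)).sub
      (tendsto_gaussPrimitive_comp_atTop_of_pos w hm)).div_const _)
  · refine ⟨key.1, key.2.trans ?_⟩
    rw [mul_neg, neg_mul, mul_comm w]
    field_simp
    ring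
  · have ht : 0 < t := ht
    have hs : 0 < √t := Real.sqrt_pos.2 ht
    rw [Real.sqrt_mul (by positivity) t]
    field_simp
    ring

/-- Tonelli's theorem for a nonnegative function whose sections in the first variable have
known integrals. -/
theorem integrable_prod_of_nonneg_of_integral_eq {X Y : Type*} [MeasurableSpace X]
    [MeasurableSpace Y] {μ : Measure X} {ν : Measure Y} [SFinite μ] [SFinite ν] {f : X → Y → ℝ}
    {g : Y → ℝ} (hf : AEStronglyMeasurable (fun p : X × Y => f p.1 p.2) (μ.prod ν))
    (hnonneg : ∀ᵐ y ∂ν, ∀ x, 0 ≤ f x y) (hint : ∀ᵐ y ∂ν, Integrable (fun x => f x y) μ)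
    (hval : ∀ᵐ y ∂ν, ∫ x, f x y ∂μ = g y) (hg : Integrable g ν) :
    Integrable (fun p : X × Y => f p.1 p.2) (μ.prod ν) ∧
      ∫ x, ∫ y, f x y ∂ν ∂μ = ∫ y, g y ∂ν := by
  have h : Integrable (fun p : X × Y => f p.1 p.2) (μ.prod ν) := by
    refine (integrable_prod_iff' hf).2 ⟨hint, hg.congr ?_⟩
    filter_upwards [hval, hnonneg] with y hy hy'
    simp_rw [Real.norm_of_nonneg (hy' _), hy]
  exact ⟨h, (integral_integral_swap h).trans (integral_congr_ae hval)⟩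

theorem integral_exp_neg_mul_Ioi_zero {c : ℝ} (hc : 0 < c) :
    ∫ x in Ioi (0 : ℝ), Real.exp (-c * x) = c⁻¹ := by
  rw [integral_exp_mul_Ioi (neg_neg_of_pos hc)]
  simp

/-- Laplace transform of the Gaussian tail term of the crossing probability. -/
theorem laplace_gaussianTail {α η : ℝ} (hα : 0 < α) (hη : 0 < η) :
    IntegrableOn (fun t => Real.exp (-η * t) * (Real.exp (α ^ 2 * t / 2) *
      ∫ w in Ioi (α * √t), Real.exp (-(w ^ 2) / 2) / √(2 * π))) (Ioi 0) ∧
    ∫ t in Ioi (0 : ℝ), Real.exp (-η * t) * (Real.exp (α ^ 2 * t / 2) *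
      ∫ w in Ioi (α * √t), Real.exp (-(w ^ 2) / 2) / √(2 * π)) =
        1 / (√(2 * η) * (√(2 * η) + α)) := by
  have hm : 0 < √(2 * η) := by positivity
  have hsub : ∀ t ∈ Ioi (0 : ℝ), ∫ v in Ioi (0 : ℝ), Real.exp (-α * v) * (Real.exp (-η * t) *
      (Real.exp (-(v ^ 2) / (2 * t)) / √(2 * π * t))) =
      Real.exp (-η * t) * (Real.exp (α ^ 2 * t / 2) *
        ∫ w in Ioi (α * √t), Real.exp (-(w ^ 2) / 2) / √(2 * π)) := by
    intro t ht
    have ht : 0 < t := ht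
    have hs : 0 < √t := Real.sqrt_pos.2 ht
    have hsq : √t ^ 2 = t := Real.sq_sqrt ht.le
    rw [setIntegral_Ioi_eq_comp_affine _ (α * √t) (inv_pos.2 hs), ← integral_const_mul,
      ← integral_const_mul, ← integral_const_mul]
    refine integral_congr_ae (ae_of_all _ fun v => ?_)
    beta_reduce
    have : Real.exp (-((α * √t + (√t)⁻¹ * v) ^ 2) / 2) =
        Real.exp (-(α ^ 2 * t / 2)) * Real.exp (-α * v) * Real.exp (-(v ^ 2) / (2 * t)) := by
      rw [← Real.exp_add, ← Real.exp_add]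
      congr 1
      have : (α * √t + (√t)⁻¹ * v) ^ 2 = α ^ 2 * √t ^ 2 + 2 * α * v + v ^ 2 / √t ^ 2 := by
        field_simp
        ring
      rw [this, hsq]
      field_simp
      ring
    rw [this, Real.exp_neg (α ^ 2 * t / 2), Real.sqrt_mul (by positivity) t]
    field_simp
  obtain ⟨hint, hval⟩ := integrable_prod_of_nonneg_of_integral_eq
    (μ := volume.restrict (Ioi (0 : ℝ))) (ν := volume.restrict (Ioi (0 : ℝ)))
    (f := fun t v => Real.exp (-α * v) * (Real.exp (-η * t) *
      (Real.exp (-(v ^ 2) / (2 * t)) / √(2 * π * t))))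
    (g := fun v => (√(2 * η))⁻¹ * Real.exp (-(√(2 * η) + α) * v))
    (by fun_prop) (ae_of_all _ fun v t => by positivity)
    ((ae_restrict_mem measurableSet_Ioi).mono fun v hv =>
      (laplace_heatKernel hη hv).1.const_mul _)
    ((ae_restrict_mem measurableSet_Ioi).mono fun v hv => by
      rw [integral_const_mul, (laplace_heatKernel hη hv).2, neg_add, add_mul, Real.exp_add]
      ring)
    ((integrableOn_exp_mul_Ioi (by linarith) 0).const_mul _)
  constructor
  · exact hint.integral_prod_left.congr <|
      (ae_restrict_mem measurableSet_Ioi).mono fun t ht => hsub t ht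
  · rw [← setIntegral_congr_fun measurableSet_Ioi hsub, hval, integral_const_mul,
      integral_exp_neg_mul_Ioi_zero (by positivity)]
    field_simp

/-- Laplace transform of the first passage term of the crossing probability. -/
theorem laplace_firstPassage_average {α lam η : ℝ} (hα : 0 < α) (hlam : 0 < lam) (hη : 0 < η) :
    IntegrableOn (fun t => Real.exp (-η * t) * ∫ s in Ioi (0 : ℝ), Real.exp (-(lam - α) * s) *
      ∫ w in Ioi s, w * Real.exp (-α * w) * Real.exp (-(w ^ 2) / (2 * t)) /
        √(2 * π * t ^ 3)) (Ioi 0) ∧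
    ∫ t in Ioi (0 : ℝ), Real.exp (-η * t) * ∫ s in Ioi (0 : ℝ), Real.exp (-(lam - α) * s) *
      ∫ w in Ioi s, w * Real.exp (-α * w) * Real.exp (-(w ^ 2) / (2 * t)) /
        √(2 * π * t ^ 3) =
      1 / ((√(2 * η) + α) * (√(2 * η) + lam)) := by
  have hm : 0 < √(2 * η) := by positivity
  set ν := (volume.restrict (Ioi (0 : ℝ))).prod (volume.restrict (Ioi (0 : ℝ))) with hν
  have hmem : ∀ᵐ p ∂ν, 0 < p.1 + p.2 := by
    rw [hν, Measure.prod_restrict]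
    filter_upwards [ae_restrict_mem (measurableSet_Ioi.prod measurableSet_Ioi)] with p hp
    exact add_pos hp.1 hp.2
  obtain ⟨hint, hval⟩ := integrable_prod_of_nonneg_of_integral_eq
    (μ := volume.restrict (Ioi (0 : ℝ))) (ν := ν)
    (f := fun t p => Real.exp (-(lam - α) * p.1) * Real.exp (-α * (p.1 + p.2)) *
      (Real.exp (-η * t) * ((p.1 + p.2) * Real.exp (-((p.1 + p.2) ^ 2) / (2 * t)) /
        √(2 * π * t ^ 3))))
    (g := fun p => Real.exp (-(√(2 * η) + lam) * p.1) * Real.exp (-(√(2 * η) + α) * p.2))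
    (by fun_prop) (hmem.mono fun p hp t => by positivity)
    (hmem.mono fun p hp => (laplace_firstPassage hη hp).1.const_mul _)
    (hmem.mono fun p hp => by
      rw [integral_const_mul, (laplace_firstPassage hη hp).2, ← Real.exp_add, ← Real.exp_add,
        ← Real.exp_add]
      congr 1
      ring)
    ((integrableOn_exp_mul_Ioi (by linarith) 0).mul_prod
      (integrableOn_exp_mul_Ioi (by linarith) 0))
  have hsub : ∀ᵐ t ∂(volume.restrict (Ioi (0 : ℝ))), ∫ p, Real.exp (-(lam - α) * p.1) *
      Real.exp (-α * (p.1 + p.2)) * (Real.exp (-η * t) * ((p.1 + p.2) *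
        Real.exp (-((p.1 + p.2) ^ 2) / (2 * t)) / √(2 * π * t ^ 3))) ∂ν =
      Real.exp (-η * t) * ∫ s in Ioi (0 : ℝ), Real.exp (-(lam - α) * s) *
        ∫ w in Ioi s, w * Real.exp (-α * w) * Real.exp (-(w ^ 2) / (2 * t)) /
          √(2 * π * t ^ 3) := by
    filter_upwards [hint.prod_right_ae] with t ht
    rw [integral_prod _ ht, ← integral_const_mul]
    congr 1 with s
    rw [setIntegral_Ioi_eq_comp_affine _ s one_pos, one_mul, ← integral_const_mul,
      ← integral_const_mul]
    congr 1 with v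
    rw [one_mul]
    ring
  constructor
  · exact hint.integral_prod_left.congr hsub
  · rw [← integral_congr_ae hsub, hval, hν,
      integral_prod_mul (fun s => Real.exp (-(√(2 * η) + lam) * s))
        (fun v => Real.exp (-(√(2 * η) + α) * v)),
      integral_exp_neg_mul_Ioi_zero (by positivity), integral_exp_neg_mul_Ioi_zero (by positivity)]
    field_simp

theorem elastic_crossing_laplace_transform (α lam : ℝ) (hα : 0 < α) (hlam : 0 < lam) :
    ∀ η > (0:ℝ),
      (∫ t in Set.Ioi (0:ℝ), Real.exp (-η * t) * psiEl α lam t) =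
        (α * lam * η⁻¹ + Real.sqrt 2 * α * (Real.sqrt η)⁻¹ + 2) /
          ((Real.sqrt (2 * η) + α) * (Real.sqrt (2 * η) + lam)) := by
  intro η hη
  obtain ⟨hint₁, hval₁⟩ := laplace_firstPassage_average hα hlam hη
  obtain ⟨hint₂, hval₂⟩ := laplace_gaussianTail hα hη
  have hint₀ := integrableOn_exp_mul_Ioi (neg_neg_of_pos hη) 0
  have hsplit : ∀ t, Real.exp (-η * t) * psiEl α lam t =
      2 * (Real.exp (-η * t) * ∫ s in Ioi (0 : ℝ), Real.exp (-(lam - α) * s) *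
        ∫ w in Ioi s, w * Real.exp (-α * w) * Real.exp (-(w ^ 2) / (2 * t)) /
          √(2 * π * t ^ 3)) + Real.exp (-η * t) -
      2 * (Real.exp (-η * t) * (Real.exp (α ^ 2 * t / 2) *
        ∫ w in Ioi (α * √t), Real.exp (-(w ^ 2) / 2) / √(2 * π))) := fun t => by
    rw [psiEl]
    ring
  simp_rw [hsplit]
  rw [integral_sub ((hint₁.const_mul 2).fun_add hint₀) (hint₂.const_mul 2),
    integral_add (hint₁.const_mul 2) hint₀, integral_const_mul, integral_const_mul, hval₁, hval₂,
    integral_exp_neg_mul_Ioi_zero hη, Real.sqrt_mul zero_le_two]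
  have h2 : 0 < √(2 : ℝ) := by positivity
  have hr : 0 < √η := Real.sqrt_pos.2 hη
  have hr2 : η = √η ^ 2 := (Real.sq_sqrt hη.le).symm
  have h22 : √(2 : ℝ) ^ 2 = 2 := Real.sq_sqrt zero_le_two
  generalize √η = r at *
  generalize √(2 : ℝ) = q at *
  subst hr2
  field_simp
  linear_combination (q * r ^ 2 + r * lam) * h22
end

section
/- Let α, λ > 0 with α ≠ λ. Then for every t > 0, ψ^el_α(t) = 1 − (λ/(λ − α)) · [ E_{1/2,1}(−α√t/√2) − E_{1/2,1}(−λ√t/√2) ]. -/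
open Real MeasureTheory Set

open Filter Topology intervalIntegral

/-- The standard Gaussian density. -/
noncomputable def gaussianDensity (x : ℝ) : ℝ := exp (-(x ^ 2) / 2) / √(2 * π)

/-- The upper tail of the standard Gaussian distribution. -/
noncomputable def gaussianTail (x : ℝ) : ℝ := ∫ w in Ioi x, gaussianDensity w

lemma continuous_gaussianDensity : Continuous gaussianDensity := by
  unfold gaussianDensity
  fun_prop

lemma integrable_gaussianDensity : Integrable gaussianDensity := by
  have h := (integrable_exp_neg_mul_sq (b := 1 / 2) (by norm_num)).div_const √(2 * π)
  refine h.congr (Eventually.of_forall fun x ↦ ?_)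
  simp only [gaussianDensity]
  ring_nf

lemma gaussianTail_nonneg (x : ℝ) : 0 ≤ gaussianTail x :=
  setIntegral_nonneg measurableSet_Ioi fun w _ ↦ by unfold gaussianDensity; positivity

lemma gaussianTail_zero : gaussianTail 0 = 1 / 2 := by
  have h := integral_gaussian_Ioi (1 / 2)
  have e : π / (1 / 2) = 2 * π := by ring
  have hp : √(2 * π) ≠ 0 := by positivity
  rw [e] at h
  simp only [gaussianTail, gaussianDensity]
  rw [MeasureTheory.integral_div]
  have e2 : ∀ x : ℝ, -(x ^ 2) / 2 = -(1 / 2) * x ^ 2 := fun x ↦ by ring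
  simp only [e2, h]
  field_simp

lemma gaussianTail_eq (x : ℝ) : gaussianTail x = 1 / 2 - ∫ w in (0 : ℝ)..x, gaussianDensity w := by
  have h := integral_interval_add_Ioi (a := 0) (b := x)
    integrable_gaussianDensity.integrableOn integrable_gaussianDensity.integrableOn
  have h0 := gaussianTail_zero
  unfold gaussianTail at *
  linarith

lemma hasDerivAt_gaussianTail (x : ℝ) : HasDerivAt gaussianTail (-gaussianDensity x) x := by
  have h := (continuous_gaussianDensity.integral_hasStrictDerivAt 0 x).hasDerivAt.const_sub (1 / 2)
  rwa [← show gaussianTail = fun x ↦ 1 / 2 - ∫ w in (0 : ℝ)..x, gaussianDensity w from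
    funext gaussianTail_eq] at h

lemma tendsto_gaussianTail_atTop : Tendsto gaussianTail atTop (𝓝 0) := by
  have h := (intervalIntegral_tendsto_integral_Ioi 0
    integrable_gaussianDensity.integrableOn tendsto_id).const_sub (1 / 2)
  rw [show ∫ x in Ioi 0, gaussianDensity x = 1 / 2 from gaussianTail_zero, sub_self] at h
  exact h.congr fun x ↦ (gaussianTail_eq x).symm

lemma integral_one_sub_sq_pow (k : ℕ) :
    ∫ v in (0 : ℝ)..1, (1 - v ^ 2) ^ k = √π / 2 * k.factorial / Gamma (k + 3 / 2) := by
  have hp : √π ≠ 0 := by positivity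
  induction k with
  | zero =>
    have : Gamma (3 / 2) = 1 / 2 * √π := by
      rw [show (3 / 2 : ℝ) = 1 / 2 + 1 by norm_num, Gamma_add_one (by norm_num), Gamma_one_half_eq]
    simp [this]
    field_simp
  | succ k ih =>
    have hd : ∀ v ∈ uIcc (0 : ℝ) 1, HasDerivAt (fun v : ℝ ↦ v * (1 - v ^ 2) ^ (k + 1))
        ((2 * k + 3) * (1 - v ^ 2) ^ (k + 1) - 2 * (k + 1) * (1 - v ^ 2) ^ k) v := by
      intro v _
      have h := (hasDerivAt_id v).mul ((((hasDerivAt_id v).pow 2).const_sub 1).pow (k + 1))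
      refine (h.congr_deriv ?_)
      simp
      ring
    have hint := integral_eq_sub_of_hasDerivAt hd (Continuous.intervalIntegrable (by fun_prop) _ _)
    rw [integral_sub (Continuous.intervalIntegrable (by fun_prop) _ _)
      (Continuous.intervalIntegrable (by fun_prop) _ _), intervalIntegral.integral_const_mul,
      intervalIntegral.integral_const_mul, ih] at hint
    have hG : Gamma (((k + 1 : ℕ) : ℝ) + 3 / 2) = (k + 3 / 2) * Gamma (k + 3 / 2) := by
      rw [← Gamma_add_one (by positivity)]
      push_cast
      ring_nf
    have hG0 : Gamma ((k : ℝ) + 3 / 2) ≠ 0 := (Gamma_pos_of_pos (by positivity)).ne'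
    rw [hG, Nat.factorial_succ]
    push_cast
    simp at hint
    have h3 : (2 * (k : ℝ) + 3) ≠ 0 := by positivity
    apply mul_left_cancel₀ h3
    rw [sub_eq_zero.mp hint]
    field_simp

lemma hasSum_exp_series (x : ℝ) : HasSum (fun k : ℕ ↦ x ^ k / k.factorial) (exp x) := by
  rw [exp_eq_exp_ℝ]
  exact NormedSpace.expSeries_div_hasSum_exp x

lemma hasSum_integral_exp_one_sub_sq (c : ℝ) :
    HasSum (fun k : ℕ ↦ √π / 2 * c ^ k / Gamma (k + 3 / 2))
      (∫ v in (0 : ℝ)..1, exp (c * (1 - v ^ 2))) := by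
  have h : HasSum (fun k : ℕ ↦ ∫ v in (0 : ℝ)..1, (c * (1 - v ^ 2)) ^ k / k.factorial)
      (∫ v in (0 : ℝ)..1, exp (c * (1 - v ^ 2))) := by
    refine hasSum_integral_of_dominated_convergence (fun k _ ↦ |c| ^ k / k.factorial)
      (fun k ↦ Continuous.aestronglyMeasurable (by fun_prop)) ?_ ?_ ?_ ?_
    · refine fun k ↦ Eventually.of_forall fun v hv ↦ ?_
      rw [uIoc_of_le zero_le_one] at hv
      rw [norm_div, norm_pow, norm_mul, RCLike.norm_natCast]
      gcongr
      refine mul_le_of_le_one_right (abs_nonneg c) ?_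
      rw [Real.norm_eq_abs, abs_le]
      constructor <;> nlinarith [hv.1, hv.2]
    · exact Eventually.of_forall fun v _ ↦ (hasSum_exp_series |c|).summable
    · simp
    · exact Eventually.of_forall fun v _ ↦ hasSum_exp_series _
  refine h.congr_fun fun k ↦ ?_
  have e : ∀ v : ℝ, (c * (1 - v ^ 2)) ^ k / k.factorial =
      c ^ k / k.factorial * (1 - v ^ 2) ^ k := fun v ↦ by rw [mul_pow]; ring
  have hk : (k.factorial : ℝ) ≠ 0 := by positivity
  simp only [e]
  rw [intervalIntegral.integral_const_mul, integral_one_sub_sq_pow]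
  field_simp

lemma integral_gaussianDensity (x : ℝ) : ∫ w in (0 : ℝ)..x, gaussianDensity w =
    x / √(2 * π) * exp (-(x ^ 2 / 2)) * ∫ v in (0 : ℝ)..1, exp (x ^ 2 / 2 * (1 - v ^ 2)) := by
  have h := smul_integral_comp_mul_left (a := 0) (b := 1) gaussianDensity x
  rw [mul_zero, mul_one] at h
  rw [← h, smul_eq_mul, ← intervalIntegral.integral_const_mul,
    ← intervalIntegral.integral_const_mul]
  congr 1 with v
  rw [mul_assoc, ← Real.exp_add, gaussianDensity]
  ring_nf

lemma neg_div_sqrt_two_sq (x : ℝ) : (-(x / √2)) ^ 2 = x ^ 2 / 2 := by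
  rw [neg_sq, div_pow, Real.sq_sqrt zero_le_two]

lemma hasSum_mittagLeffler_one_half_even (x : ℝ) :
    HasSum (fun k : ℕ ↦ (-(x / √2)) ^ (2 * k) / Gamma (1 / 2 * ((2 * k : ℕ) : ℝ) + 1))
      (exp (x ^ 2 / 2)) := by
  refine (hasSum_exp_series (x ^ 2 / 2)).congr_fun fun k ↦ ?_
  have e : 1 / 2 * ((2 * k : ℕ) : ℝ) + 1 = k + 1 := by push_cast; ring
  rw [pow_mul, neg_div_sqrt_two_sq, e, Gamma_nat_eq_factorial]

lemma hasSum_mittagLeffler_one_half_odd (x : ℝ) :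
    HasSum (fun k : ℕ ↦ (-(x / √2)) ^ (2 * k + 1) / Gamma (1 / 2 * ((2 * k + 1 : ℕ) : ℝ) + 1))
      (-(x / √2) * (2 / √π) * ∫ v in (0 : ℝ)..1, exp (x ^ 2 / 2 * (1 - v ^ 2))) := by
  refine ((hasSum_integral_exp_one_sub_sq (x ^ 2 / 2)).mul_left _).congr_fun fun k ↦ ?_
  have e : 1 / 2 * ((2 * k + 1 : ℕ) : ℝ) + 1 = k + 3 / 2 := by push_cast; ring
  have hp : √π ≠ 0 := by positivity
  rw [pow_succ, pow_mul, neg_div_sqrt_two_sq, e]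
  field_simp

/-- The Mittag-Leffler function of order `1/2` is a scaled complementary error function. -/
lemma mittagLeffler_one_half (x : ℝ) :
    mittagLeffler (1 / 2) 1 (-(x / √2)) = 2 * exp (x ^ 2 / 2) * gaussianTail x := by
  have hexp : exp (x ^ 2 / 2) * exp (-(x ^ 2 / 2)) = 1 := by rw [← Real.exp_add]; simp
  have hsum := ((hasSum_mittagLeffler_one_half_even x).even_add_odd
    (f := fun r : ℕ ↦ (-(x / √2)) ^ r / Gamma (1 / 2 * (r : ℝ) + 1))
    (hasSum_mittagLeffler_one_half_odd x)).tsum_eq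
  rw [mittagLeffler, hsum, gaussianTail_eq, integral_gaussianDensity, Real.sqrt_mul zero_le_two]
  linear_combination (2 * x / (√2 * √π) *
    ∫ v in (0 : ℝ)..1, exp (x ^ 2 / 2 * (1 - v ^ 2))) * hexp

section Laplace

variable {t : ℝ}

lemma hasDerivAt_gaussianTail_affine (ht : 0 < t) (a s : ℝ) :
    HasDerivAt (fun s ↦ a * exp (a ^ 2 * t / 2) * gaussianTail (s / √t + a * √t))
      (-(a * (exp (-a * s) * exp (-(s ^ 2) / (2 * t)) / √(2 * π * t)))) s := by
  have h1 : HasDerivAt (fun s ↦ s / √t + a * √t) (1 / √t) s :=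
    ((hasDerivAt_id s).div_const √t).add_const _
  have h := ((hasDerivAt_gaussianTail _).comp s h1).const_mul (a * exp (a ^ 2 * t / 2))
  refine h.congr_deriv ?_
  have hs : √t ≠ 0 := by positivity
  have hst : √t ^ 2 = t := Real.sq_sqrt ht.le
  have e : exp (a ^ 2 * t / 2) * exp (-((s / √t + a * √t) ^ 2) / 2) =
      exp (-a * s) * exp (-(s ^ 2) / (2 * t)) := by
    rw [← Real.exp_add, ← Real.exp_add]
    congr 1
    have : (s / √t + a * √t) ^ 2 = s ^ 2 / t + 2 * a * s + a ^ 2 * t := by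
      rw [add_sq, div_pow, mul_pow, hst]
      field_simp
    rw [this]
    field_simp
    ring
  have hr : √(2 * π * t) = √(2 * π) * √t := Real.sqrt_mul (by positivity) t
  have hp : √(2 * π) ≠ 0 := by positivity
  rw [gaussianDensity, hr, ← e]
  field_simp

lemma tendsto_gaussianTail_affine (ht : 0 < t) (a : ℝ) :
    Tendsto (fun s ↦ a * exp (a ^ 2 * t / 2) * gaussianTail (s / √t + a * √t)) atTop (𝓝 0) := by
  have h1 : Tendsto (fun s ↦ s / √t + a * √t) atTop atTop :=
    tendsto_atTop_add_const_right _ _ (tendsto_id.atTop_div_const (by positivity))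
  simpa using (tendsto_gaussianTail_atTop.comp h1).const_mul (a * exp (a ^ 2 * t / 2))

lemma tendsto_exp_mul_gaussian (ht : 0 < t) {a : ℝ} (ha : 0 < a) :
    Tendsto (fun s ↦ exp (-a * s) * exp (-(s ^ 2) / (2 * t)) / √(2 * π * t)) atTop (𝓝 0) := by
  have h : Tendsto (fun s ↦ exp (-a * s) / √(2 * π * t)) atTop (𝓝 0) := by
    have := (Real.tendsto_exp_atBot.comp
      (tendsto_id.const_mul_atTop_of_neg (neg_lt_zero.mpr ha))).div_const √(2 * π * t)
    simpa using this
  refine squeeze_zero (fun s ↦ by positivity) (fun s ↦ ?_) h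
  gcongr
  refine mul_le_of_le_one_right (Real.exp_pos _).le (Real.exp_le_one_iff.mpr ?_)
  exact div_nonpos_of_nonpos_of_nonneg (by nlinarith [sq_nonneg s]) (by positivity)

lemma hasDerivAt_exp_mul_gaussian (ht : 0 < t) (a s : ℝ) :
    HasDerivAt (fun s ↦ exp (-a * s) * exp (-(s ^ 2) / (2 * t)) / √(2 * π * t))
      (-(a + s / t) * (exp (-a * s) * exp (-(s ^ 2) / (2 * t)) / √(2 * π * t))) s := by
  have h1 : HasDerivAt (fun s ↦ exp (-a * s)) (exp (-a * s) * -a) s := by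
    simpa using ((hasDerivAt_id s).const_mul (-a)).exp
  have h2 : HasDerivAt (fun s ↦ exp (-(s ^ 2) / (2 * t)))
      (exp (-(s ^ 2) / (2 * t)) * (-(2 * s) / (2 * t))) s := by
    simpa using (((hasDerivAt_id s).pow 2).neg.div_const (2 * t)).exp
  refine ((h1.mul h2).div_const _).congr_deriv ?_
  field_simp
  ring

lemma integral_Ioi_mul_exp_mul_gaussian (ht : 0 < t) {a s : ℝ} (ha : 0 < a) (hs : 0 ≤ s) :
    ∫ w in Ioi s, w * exp (-a * w) * exp (-(w ^ 2) / (2 * t)) / √(2 * π * t ^ 3) =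
      exp (-a * s) * exp (-(s ^ 2) / (2 * t)) / √(2 * π * t) -
        a * exp (a ^ 2 * t / 2) * gaussianTail (s / √t + a * √t) := by
  have hr : √(2 * π * t ^ 3) = √(2 * π * t) * t := by
    rw [show 2 * π * t ^ 3 = (2 * π * t) * t ^ 2 by ring, Real.sqrt_mul (by positivity),
      Real.sqrt_sq ht.le]
  have hp : √(2 * π * t) ≠ 0 := by positivity
  have hlim := (tendsto_gaussianTail_affine ht a).sub (tendsto_exp_mul_gaussian ht ha)
  have h := integral_Ioi_of_hasDerivAt_of_nonneg' (a := s)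
    (g' := fun w ↦ w * exp (-a * w) * exp (-(w ^ 2) / (2 * t)) / √(2 * π * t ^ 3))
    (fun w _ ↦ ((hasDerivAt_gaussianTail_affine ht a w).sub
      (hasDerivAt_exp_mul_gaussian ht a w)).congr_deriv ?_)
    (fun w hw ↦ ?_) hlim
  · rw [h]
    simp
  · rw [hr]
    field_simp
    ring
  · have : 0 ≤ w := hs.trans (le_of_lt hw)
    positivity

lemma tendsto_exp_mul_gaussianTail_affine (ht : 0 < t) {α lam : ℝ} (hα : 0 < α) (hlam : 0 < lam) :
    Tendsto (fun s ↦ exp (-(lam - α) * s) *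
      (α * exp (α ^ 2 * t / 2) * gaussianTail (s / √t + α * √t))) atTop (𝓝 0) := by
  refine squeeze_zero' (Eventually.of_forall fun s ↦ ?_) ?_ (tendsto_exp_mul_gaussian ht hlam)
  · have := gaussianTail_nonneg (s / √t + α * √t)
    positivity
  · filter_upwards [eventually_ge_atTop 0] with s hs
    have h0 : 0 ≤ ∫ w in Ioi s,
        w * exp (-α * w) * exp (-(w ^ 2) / (2 * t)) / √(2 * π * t ^ 3) :=
      setIntegral_nonneg measurableSet_Ioi fun w hw ↦ by
        have : 0 ≤ w := hs.trans (le_of_lt hw)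
        positivity
    rw [integral_Ioi_mul_exp_mul_gaussian ht hα hs, sub_nonneg] at h0
    have e : exp (-lam * s) = exp (-(lam - α) * s) * exp (-α * s) := by
      rw [← Real.exp_add]
      ring_nf
    refine (mul_le_mul_of_nonneg_left h0 (Real.exp_pos (-(lam - α) * s)).le).trans_eq ?_
    rw [e]
    ring

lemma integral_exp_mul_integral_gaussian (ht : 0 < t) {α lam : ℝ} (hα : 0 < α) (hlam : 0 < lam)
    (hne : α ≠ lam) :
    ∫ s in Ioi (0 : ℝ), exp (-(lam - α) * s) *
      ∫ w in Ioi s, w * exp (-α * w) * exp (-(w ^ 2) / (2 * t)) / √(2 * π * t ^ 3) =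
      (lam * exp (lam ^ 2 * t / 2) * gaussianTail (lam * √t) -
        α * exp (α ^ 2 * t / 2) * gaussianTail (α * √t)) / (lam - α) := by
  have hk : lam - α ≠ 0 := sub_ne_zero.mpr hne.symm
  have e (s : ℝ) : exp (-lam * s) = exp (-(lam - α) * s) * exp (-α * s) := by
    rw [← Real.exp_add]
    ring_nf
  have hlim := ((tendsto_exp_mul_gaussianTail_affine ht hα hlam).sub
    (tendsto_gaussianTail_affine ht lam)).div_const (lam - α)
  have hexp (s : ℝ) : HasDerivAt (fun s ↦ exp (-(lam - α) * s))
      (exp (-(lam - α) * s) * -(lam - α)) s := by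
    simpa using ((hasDerivAt_id s).const_mul (-(lam - α))).exp
  have h := integral_Ioi_of_hasDerivAt_of_nonneg' (a := 0)
    (g' := fun s ↦ exp (-(lam - α) * s) *
      ∫ w in Ioi s, w * exp (-α * w) * exp (-(w ^ 2) / (2 * t)) / √(2 * π * t ^ 3))
    (fun s hs ↦ ((((hexp s).mul (hasDerivAt_gaussianTail_affine ht α s)).sub
      (hasDerivAt_gaussianTail_affine ht lam s)).div_const (lam - α)).congr_deriv ?_)
    (fun s hs ↦ ?_) hlim
  · rw [h]
    simp
    field_simp
    ring
  · rw [integral_Ioi_mul_exp_mul_gaussian ht hα hs, e]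
    field_simp
    ring
  · refine mul_nonneg (Real.exp_pos _).le
      (setIntegral_nonneg measurableSet_Ioi fun w hw ↦ ?_)
    have : 0 ≤ w := (lt_trans hs hw).le
    positivity

end Laplace

theorem elastic_crossing_eq_mittagLeffler (α lam : ℝ) (hα : 0 < α) (hlam : 0 < lam)
    (hne : α ≠ lam) :
    ∀ t > (0:ℝ),
      psiEl α lam t =
        1 - (lam / (lam - α)) *
          (mittagLeffler (1/2) 1 (-(α * Real.sqrt t / Real.sqrt 2)) -
            mittagLeffler (1/2) 1 (-(lam * Real.sqrt t / Real.sqrt 2))) := by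
  intro t ht
  have hk : lam - α ≠ 0 := sub_ne_zero.mpr hne.symm
  have htail : ∫ w in Ioi (α * √t), exp (-(w ^ 2) / 2) / √(2 * π) = gaussianTail (α * √t) := rfl
  have hsq (a : ℝ) : (a * √t) ^ 2 = a ^ 2 * t := by rw [mul_pow, Real.sq_sqrt ht.le]
  rw [psiEl, htail, integral_exp_mul_integral_gaussian ht hα hlam hne, mittagLeffler_one_half,
    mittagLeffler_one_half, hsq, hsq]
  field_simp
  ring
end

section
/- Let λ > 0 and take absorbing rate α = λ. Then for every t > 0, ψ^el_λ(t) = 1 − λ√(2t) · E_{1/2,1/2}(−λ√t/√2), and equivalently ψ^el_λ(t) = 1 − (λ√t/√2) · E²_{1/2,3/2}(−λ√t/√2). -/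
open Real MeasureTheory Set

theorem integrableOn_pow_mul_exp_neg_mul_gaussian (c : ℝ) (k : ℕ) :
    IntegrableOn (fun u : ℝ => u ^ k * exp (-(c * u)) * exp (-(u ^ 2) / 2)) (Ioi 0) := by
  have h : IntegrableOn (fun u : ℝ => exp (c ^ 2) * (u ^ (k : ℝ) * exp (-(1 / 4) * u ^ 2)))
      (Ioi 0) :=
    (integrableOn_rpow_mul_exp_neg_mul_sq (by norm_num)
      (by have : (0 : ℝ) ≤ k := k.cast_nonneg
          linarith)).const_mul _
  refine Integrable.mono' h (by fun_prop) ?_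
  filter_upwards [ae_restrict_mem measurableSet_Ioi] with u hu
  have hu : 0 < u := hu
  rw [norm_of_nonneg (by positivity), rpow_natCast, mul_assoc, ← exp_add,
    mul_left_comm (exp (c ^ 2)), ← exp_add]
  refine mul_le_mul_of_nonneg_left (exp_le_exp.mpr ?_) (by positivity)
  nlinarith [sq_nonneg (c + u / 2)]

theorem integral_sq_sub_one_mul_exp_neg_mul_gaussian (c : ℝ) :
    (∫ u in Ioi (0 : ℝ), u ^ 2 * exp (-(c * u)) * exp (-(u ^ 2) / 2)) -
        ∫ u in Ioi (0 : ℝ), exp (-(c * u)) * exp (-(u ^ 2) / 2) =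
      -(c * ∫ u in Ioi (0 : ℝ), u * exp (-(c * u)) * exp (-(u ^ 2) / 2)) := by
  have h0 := integrableOn_pow_mul_exp_neg_mul_gaussian c 0
  have h1 := integrableOn_pow_mul_exp_neg_mul_gaussian c 1
  have h2 := integrableOn_pow_mul_exp_neg_mul_gaussian c 2
  simp only [pow_zero, one_mul, pow_one] at h0 h1
  have hderiv : ∀ u : ℝ, HasDerivAt (fun u : ℝ => u * exp (-(c * u)) * exp (-(u ^ 2) / 2))
      (exp (-(c * u)) * exp (-(u ^ 2) / 2) - c * (u * exp (-(c * u)) * exp (-(u ^ 2) / 2)) -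
        u ^ 2 * exp (-(c * u)) * exp (-(u ^ 2) / 2)) u := by
    intro u
    have ha : HasDerivAt (fun u : ℝ => -(c * u)) (-(c * 1)) u :=
      ((hasDerivAt_id u).const_mul c).neg
    have hb : HasDerivAt (fun u : ℝ => -(u ^ 2) / 2) (-(2 * u) / 2) u := by
      simpa using ((hasDerivAt_pow 2 u).neg.div_const 2)
    convert! ((hasDerivAt_id u).mul ha.exp).mul hb.exp using 1
    simp only [id, Pi.mul_apply]
    ring
  have h01 : IntegrableOn (fun u : ℝ => exp (-(c * u)) * exp (-(u ^ 2) / 2) -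
      c * (u * exp (-(c * u)) * exp (-(u ^ 2) / 2))) (Ioi 0) := h0.sub (h1.const_mul c)
  have hint := h01.sub h2
  have hlim := tendsto_zero_of_hasDerivAt_of_integrableOn_Ioi (fun u _ => hderiv u) hint h1
  have key := integral_Ioi_of_hasDerivAt_of_tendsto' (fun u _ => hderiv u) hint hlim
  rw [integral_sub h01 h2, integral_sub h0 (h1.const_mul c),
    integral_const_mul] at key
  simp only [zero_mul, sub_zero] at key
  linarith

theorem exp_mul_integral_Ioi_gaussian (c : ℝ) :
    exp (c ^ 2 / 2) * ∫ w in Ioi c, exp (-(w ^ 2) / 2) =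
      ∫ u in Ioi (0 : ℝ), exp (-(c * u)) * exp (-(u ^ 2) / 2) := by
  have h := (measurePreserving_add_right (volume : Measure ℝ) c).setIntegral_preimage_emb
    (measurableEmbedding_addRight c) (fun w => exp (-(w ^ 2) / 2)) (Ioi c)
  rw [← h, ← integral_const_mul]
  simp only [preimage_add_const_Ioi, sub_self, ← exp_add]
  congr 1 with u
  ring_nf

theorem integral_integral_Ioi_eq_integral_mul {f : ℝ → ℝ} (hf : Measurable f)
    (hint : IntegrableOn (fun w => w * f w) (Ioi 0)) :
    ∫ s in Ioi (0 : ℝ), ∫ w in Ioi s, f w = ∫ w in Ioi (0 : ℝ), w * f w := by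
  set F : ℝ → ℝ → ℝ := fun s w => {p : ℝ × ℝ | p.1 < p.2}.indicator (fun p => f p.2) (s, w)
  have hset : MeasurableSet {p : ℝ × ℝ | p.1 < p.2} :=
    measurableSet_lt measurable_fst measurable_snd
  have hmeas : Measurable (Function.uncurry F) :=
    (hf.comp measurable_snd).indicator hset
  have hslice : ∀ w : ℝ, (fun s => F s w) = (Iio w).indicator fun _ => f w := by
    intro w
    ext s
    simp [F, indicator]
  have hvol : ∀ w : ℝ, ((volume.restrict (Ioi (0 : ℝ))).restrict (Iio w)) =
      volume.restrict (Ioo 0 w) := fun w => by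
    rw [Measure.restrict_restrict measurableSet_Iio, inter_comm, Ioi_inter_Iio]
  have hF : Integrable (Function.uncurry F)
      ((volume.restrict (Ioi 0)).prod (volume.restrict (Ioi 0))) := by
    rw [integrable_prod_iff' hmeas.aestronglyMeasurable]
    constructor
    · filter_upwards [ae_restrict_mem measurableSet_Ioi] with w hw
      simp only [Function.uncurry_apply_pair, hslice]
      rw [integrable_indicator_iff measurableSet_Iio, IntegrableOn, hvol w]
      exact integrable_const _
    · refine hint.norm.congr ?_
      filter_upwards [ae_restrict_mem measurableSet_Ioi] with w hw
      have hw : 0 < w := hw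
      have : (fun s => ‖F s w‖) = (Iio w).indicator fun _ => ‖f w‖ := by
        ext s
        rw [show F s w = _ from congrFun (hslice w) s, norm_indicator_eq_indicator_norm]
      simp only [Function.uncurry_apply_pair, this]
      rw [integral_indicator measurableSet_Iio, hvol w]
      simp [hw.le, abs_of_pos hw]
  have hswap := integral_integral_swap hF
  have hl : ∀ s ∈ Ioi (0 : ℝ), ∫ w in Ioi (0 : ℝ), F s w = ∫ w in Ioi s, f w := by
    intro s hs
    have : (fun w => F s w) = (Ioi s).indicator f := by
      ext w
      simp [F, indicator]
    rw [this, integral_indicator measurableSet_Ioi, Measure.restrict_restrict measurableSet_Ioi,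
      inter_eq_left.mpr (Ioi_subset_Ioi (le_of_lt hs))]
  have hr : ∀ w ∈ Ioi (0 : ℝ), ∫ s in Ioi (0 : ℝ), F s w = w * f w := by
    intro w hw
    have hw' : 0 < w := hw
    rw [hslice, integral_indicator measurableSet_Iio, hvol w]
    simp [hw'.le]
  rwa [setIntegral_congr_fun measurableSet_Ioi hl, setIntegral_congr_fun measurableSet_Ioi hr]
    at hswap

theorem integral_pow_succ_mul_gaussian (r : ℕ) :
    ∫ u in Ioi (0 : ℝ), u ^ (r + 1) * exp (-(u ^ 2) / 2) =
      √π * r.factorial / (√2 ^ r * Gamma (1 / 2 * r + 1 / 2)) := by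
  have h := integral_rpow_mul_exp_neg_mul_rpow (p := 2) (q := r + 1) (b := 1 / 2) (by norm_num)
    (by have : (0 : ℝ) ≤ r := r.cast_nonneg
        linarith) (by norm_num)
  have hd := Gamma_mul_Gamma_add_half (1 / 2 * r + 1 / 2)
  have hG : 0 < Gamma (1 / 2 * r + 1 / 2) := Gamma_pos_of_pos (by positivity)
  rw [show 2 * (1 / 2 * (r : ℝ) + 1 / 2) = r + 1 by ring, Gamma_nat_eq_factorial,
    show 1 - ((r : ℝ) + 1) = -r by ring, rpow_neg two_pos.le, rpow_natCast,
    show 1 / 2 * (r : ℝ) + 1 / 2 + 1 / 2 = (r + 1 + 1) / 2 by ring] at hd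
  have hp : ((1 : ℝ) / 2) ^ (-((r : ℝ) + 1 + 1) / 2) = √2 ^ r * 2 := by
    rw [one_div, inv_rpow two_pos.le, ← rpow_neg two_pos.le,
      show -(-((r : ℝ) + 1 + 1) / 2) = 1 / 2 * r + 1 by ring, rpow_add two_pos, rpow_one,
      rpow_mul two_pos.le, rpow_natCast, ← sqrt_eq_rpow]
  have hs : (√2 ^ r) * √2 ^ r = 2 ^ r := by
    rw [← mul_pow, mul_self_sqrt two_pos.le]
  have hs0 : 0 < √2 ^ r := by positivity
  rw [hp] at h
  have hl : ∫ u in Ioi (0 : ℝ), u ^ (r + 1) * exp (-(u ^ 2) / 2) =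
      ∫ x in Ioi (0 : ℝ), x ^ ((r : ℝ) + 1) * exp (-(1 / 2) * x ^ (2 : ℝ)) := by
    congr 1 with u
    rw [rpow_two, ← rpow_natCast]
    push_cast
    ring_nf
  rw [hl, h, eq_div_iff (by positivity)]
  have hd' : Gamma (1 / 2 * r + 1 / 2) * Gamma ((r + 1 + 1) / 2) * 2 ^ r =
      r.factorial * √π := by
    rw [hd]
    field_simp
  rw [← hs] at hd'
  linarith

theorem integral_mul_exp_neg_mul_gaussian {c : ℝ} (hc : 0 < c) :
    ∫ u in Ioi (0 : ℝ), u * exp (-(c * u)) * exp (-(u ^ 2) / 2) =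
      √π * mittagLeffler (1 / 2) (1 / 2) (-(c / √2)) := by
  have hexp : ∀ x : ℝ, HasSum (fun n : ℕ => x ^ n / n.factorial) (exp x) := fun x => by
    rw [exp_eq_exp_ℝ]
    exact NormedSpace.expSeries_div_hasSum_exp x
  have hbound : ∀ u : ℝ, HasSum
      (fun n : ℕ => (c * u) ^ n / n.factorial * (u * exp (-(u ^ 2) / 2)))
      (exp (c * u) * (u * exp (-(u ^ 2) / 2))) := fun u => (hexp _).mul_right _
  have key := hasSum_integral_of_dominated_convergence (μ := volume.restrict (Ioi (0 : ℝ)))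
    (F := fun (n : ℕ) u => (-(c * u)) ^ n / n.factorial * (u * exp (-(u ^ 2) / 2)))
    (f := fun u => exp (-(c * u)) * (u * exp (-(u ^ 2) / 2)))
    (fun n u => (c * u) ^ n / n.factorial * (u * exp (-(u ^ 2) / 2)))
    (fun n => by fun_prop) ?_ (.of_forall fun u => (hbound u).summable) ?_
    (.of_forall fun u => (hexp _).mul_right _)
  · rw [mittagLeffler, ← tsum_mul_left]
    refine Eq.trans ?_ (key.tsum_eq.symm.trans (tsum_congr fun n => ?_))
    · congr 1 with u
      ring
    · calc ∫ u in Ioi (0 : ℝ), (-(c * u)) ^ n / n.factorial * (u * exp (-(u ^ 2) / 2))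
          = ∫ u in Ioi (0 : ℝ), (-c) ^ n / n.factorial *
              (u ^ (n + 1) * exp (-(u ^ 2) / 2)) := by
            congr 1 with u
            rw [← neg_mul, mul_pow]
            ring
        _ = √π * ((-(c / √2)) ^ n / Gamma (1 / 2 * n + 1 / 2)) := by
            have : 0 < Gamma (1 / 2 * (n : ℝ) + 1 / 2) := Gamma_pos_of_pos (by positivity)
            rw [integral_const_mul, integral_pow_succ_mul_gaussian, ← neg_div, div_pow]
            field_simp
  · intro n
    filter_upwards [ae_restrict_mem measurableSet_Ioi] with u hu
    have hu : 0 < u := hu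
    rw [norm_mul, norm_div, norm_pow, norm_neg, norm_of_nonneg (by positivity : 0 ≤ c * u),
      norm_of_nonneg (by positivity : 0 ≤ u * exp (-(u ^ 2) / 2)),
      norm_of_nonneg (by positivity : (0 : ℝ) ≤ n.factorial)]
  · refine (integrableOn_pow_mul_exp_neg_mul_gaussian (-c) 1).congr (.of_forall fun u => ?_)
    simp only [(hbound u).tsum_eq]
    ring_nf

theorem gml_half_three_halves_two (z : ℝ) :
    gml (1 / 2) (3 / 2) 2 z = 2 * mittagLeffler (1 / 2) (1 / 2) z := by
  rw [gml, mittagLeffler, ← tsum_mul_left]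
  refine tsum_congr fun j => ?_
  have hprod : ∏ i ∈ Finset.range j, ((2 : ℝ) + i) = (j + 1) * j.factorial := by
    induction j with
    | zero => simp
    | succ j ih =>
      rw [Finset.prod_range_succ, ih, Nat.factorial_succ]
      push_cast
      ring
  have hG : 0 < Gamma (1 / 2 * (j : ℝ) + 1 / 2) := Gamma_pos_of_pos (by positivity)
  rw [hprod, show 1 / 2 * (j : ℝ) + 3 / 2 = 1 / 2 * j + 1 / 2 + 1 by ring,
    Gamma_add_one (by positivity)]
  have : (0 : ℝ) < j.factorial := by positivity
  field_simp

theorem psiEl_self_eq {lam t : ℝ} (ht : 0 < t) :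
    psiEl lam lam t = 1 - 2 * (lam * √t) / √(2 * π) *
      ∫ u in Ioi (0 : ℝ), u * exp (-(lam * √t * u)) * exp (-(u ^ 2) / 2) := by
  set c := lam * √t with hc
  have hst : 0 < √t := sqrt_pos.mpr ht
  have hsq : √t ^ 2 = t := sq_sqrt ht.le
  have hden : √(2 * π * t ^ 3) = √(2 * π) * √t ^ 3 := by
    rw [sqrt_mul (by positivity), show t ^ 3 = (√t ^ 3) ^ 2 by rw [pow_right_comm, hsq],
      sqrt_sq (by positivity)]
  have hpi : 0 < √(2 * π) := by positivity
  set f : ℝ → ℝ := fun w => w * exp (-lam * w) * exp (-(w ^ 2) / (2 * t)) / √(2 * π * t ^ 3)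
    with hf
  have hscale : ∀ u : ℝ, √t * u * f (√t * u) =
      (√(2 * π))⁻¹ * (√t)⁻¹ * (u ^ 2 * exp (-(c * u)) * exp (-(u ^ 2) / 2)) := by
    intro u
    have h1 : -lam * (√t * u) = -(c * u) := by rw [hc]; ring
    have h2 : -((√t * u) ^ 2) / (2 * t) = -(u ^ 2) / 2 := by
      rw [mul_pow, hsq]
      field_simp
    simp only [hf, h1, h2, hden]
    field_simp
  have hint : IntegrableOn (fun w => w * f w) (Ioi 0) := by
    have := (integrableOn_Ioi_comp_mul_left_iff (fun w => w * f w) 0 hst).mp (by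
      simp only [hscale]
      exact (integrableOn_pow_mul_exp_neg_mul_gaussian c 2).const_mul _)
    simpa using this
  have hdouble : ∫ s in Ioi (0 : ℝ), exp (-(lam - lam) * s) * ∫ w in Ioi s, f w =
      (√(2 * π))⁻¹ * ∫ u in Ioi (0 : ℝ), u ^ 2 * exp (-(c * u)) * exp (-(u ^ 2) / 2) := by
    have h := integral_comp_mul_left_Ioi (fun w => w * f w) 0 hst
    simp only [hscale, mul_zero, smul_eq_mul, integral_const_mul] at h
    simp only [sub_self, neg_zero, zero_mul, exp_zero, one_mul]
    rw [integral_integral_Ioi_eq_integral_mul (by fun_prop) hint]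
    exact mul_left_cancel₀ (inv_ne_zero hst.ne') (h.symm.trans (by ring))
  have htail : exp (lam ^ 2 * t / 2) * ∫ w in Ioi c, exp (-(w ^ 2) / 2) / √(2 * π) =
      (√(2 * π))⁻¹ * ∫ u in Ioi (0 : ℝ), exp (-(c * u)) * exp (-(u ^ 2) / 2) := by
    rw [← exp_mul_integral_Ioi_gaussian, integral_div, hc, mul_pow, hsq]
    ring
  have hibp := integral_sq_sub_one_mul_exp_neg_mul_gaussian c
  rw [psiEl, hdouble, mul_assoc 2, htail]
  linear_combination 2 * (√(2 * π))⁻¹ * hibp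

theorem elastic_crossing_eq_mittagLeffler_of_rate_eq (lam : ℝ) (hlam : 0 < lam) :
    ∀ t > (0:ℝ),
      psiEl lam lam t =
        1 - lam * Real.sqrt (2 * t) *
          mittagLeffler (1/2) (1/2) (-(lam * Real.sqrt t / Real.sqrt 2)) ∧
      psiEl lam lam t =
        1 - (lam * Real.sqrt t / Real.sqrt 2) *
          gml (1/2) (3/2) 2 (-(lam * Real.sqrt t / Real.sqrt 2)) := by
  intro t ht
  have hst : 0 < √t := sqrt_pos.mpr ht
  have hpi : 0 < √π := sqrt_pos.mpr pi_pos
  have h2 : √2 * √2 = 2 := mul_self_sqrt two_pos.le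
  rw [gml_half_three_halves_two, psiEl_self_eq ht,
    integral_mul_exp_neg_mul_gaussian (by positivity), sqrt_mul two_pos.le, sqrt_mul two_pos.le]
  have hE : 2 * (lam * √t) / (√2 * √π) = lam * (√2 * √t) / √π := by
    rw [div_eq_div_iff (by positivity) (by positivity)]
    linear_combination -(lam * √t * √π) * h2
  rw [hE]
  constructor
  · field_simp
  · field_simp
    linear_combination -(lam * √t * mittagLeffler (1 / 2) (1 / 2) (-(lam * √t / √2))) * h2
end

section
/- Let k ≥ 1 be an integer and λ > 0. For every t > 0, ∫_0^∞ (1 − F_G(y)) · e^{−y²/(4t)}/√(π t) dy = 1 − (λ√t)^k · E^k_{1/2, k/2+1}(−λ√t); that is, the crossing probability Pr{|B(t)| < G} of a Gamma-distributed boundary G by a Brownian motion with variance 2t equals 1 − (λ√t)^k E^k_{1/2,k/2+1}(−λ√t). -/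
open Real MeasureTheory Set

/-- Cumulative distribution function of a Gamma random variable with rate `lam`
and integer shape `k`. -/
noncomputable def gammaCdf (lam : ℝ) (k : ℕ) (y : ℝ) : ℝ :=
  (lam ^ k / Real.Gamma k) * ∫ z in (0:ℝ)..y, Real.exp (-lam * z) * z ^ (k - 1)

/-- The duplication formula: `Γ((m+1)/2) Γ(m/2+1) = m! √π / 2^m`. -/
theorem gamma_half_mul_gamma_half_add_one (m : ℕ) :
    Real.Gamma (((m : ℝ) + 1) / 2) * Real.Gamma ((m : ℝ) / 2 + 1) =
      (m.factorial : ℝ) * √π / 2 ^ m := by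
  have h := Real.Gamma_mul_Gamma_add_half (((m : ℝ) + 1) / 2)
  rw [show ((m : ℝ) + 1) / 2 + 1 / 2 = (m : ℝ) / 2 + 1 by ring,
    show 2 * (((m : ℝ) + 1) / 2) = (m : ℝ) + 1 by ring, Real.Gamma_nat_eq_factorial,
    show 1 - ((m : ℝ) + 1) = -(m : ℝ) by ring, Real.rpow_neg zero_le_two,
    Real.rpow_natCast] at h
  rw [h]
  ring

/-- The moments of `|B(t)|`, where `B(t)` is centred Gaussian with variance `2t`. -/
theorem integral_pow_mul_halfGaussian (m : ℕ) {t : ℝ} (ht : 0 < t) :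
    ∫ y in Ioi (0 : ℝ), y ^ m * (Real.exp (-(y ^ 2) / (4 * t)) / √(π * t)) =
      √t ^ m * (m.factorial : ℝ) / Real.Gamma ((m : ℝ) / 2 + 1) := by
  have hs : 0 < √t := Real.sqrt_pos.2 ht
  have hG : 0 < Real.Gamma ((m : ℝ) / 2 + 1) := Real.Gamma_pos_of_pos (by positivity)
  have hint := integral_rpow_mul_exp_neg_mul_rpow (p := 2) (q := m) (b := 1 / (4 * t))
    two_pos (lt_of_lt_of_le (by norm_num) m.cast_nonneg) (by positivity)
  have hb : (1 / (4 * t)) ^ (-((m : ℝ) + 1) / 2) = (2 * √t) ^ (m + 1) := by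
    have h4 : 1 / (4 * t) = (2 * √t) ^ (-2 : ℝ) := by
      rw [Real.rpow_neg (by positivity), Real.rpow_two, mul_pow, Real.sq_sqrt ht.le]
      norm_num
    rw [h4, ← Real.rpow_mul (by positivity), ← Real.rpow_natCast]
    congr 1
    push_cast
    ring
  have hfun : ∀ y : ℝ, y ^ m * (Real.exp (-(y ^ 2) / (4 * t)) / √(π * t)) =
      (y ^ (m : ℝ) * Real.exp (-(1 / (4 * t)) * y ^ (2 : ℝ))) / √(π * t) := by
    intro y
    rw [Real.rpow_natCast, Real.rpow_two, ← mul_div_assoc]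
    congr 3
    ring
  simp_rw [hfun]
  rw [integral_div, hint, hb, Real.sqrt_mul pi_pos.le, eq_div_iff hG.ne', div_mul_eq_mul_div,
    mul_assoc, gamma_half_mul_gamma_half_add_one]
  have hpi : 0 < √π := Real.sqrt_pos.2 pi_pos
  field_simp
  ring

theorem hasSum_exp_mul (x y : ℝ) :
    HasSum (fun j : ℕ => x ^ j / (j.factorial : ℝ) * y ^ j) (Real.exp (x * y)) := by
  have h := NormedSpace.expSeries_div_hasSum_exp (x * y)
  rw [← Real.exp_eq_exp_ℝ] at h
  convert! h using 2 with j
  rw [mul_pow]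
  ring

theorem hasSum_gammaCdf_succ (lam : ℝ) (n : ℕ) (y : ℝ) :
    HasSum (fun j : ℕ => lam ^ (n + 1) / (n.factorial : ℝ) *
        ((-lam) ^ j / (j.factorial : ℝ) * (y ^ (n + 1 + j) / ((n + 1 + j : ℕ) : ℝ))))
      (gammaCdf lam (n + 1) y) := by
  rw [gammaCdf]
  push_cast
  rw [Real.Gamma_nat_eq_factorial]
  refine HasSum.mul_left _ ?_
  have h := intervalIntegral.hasSum_integral_of_dominated_convergence (μ := volume)
    (a := 0) (b := y)
    (F := fun (j : ℕ) (z : ℝ) => (-lam) ^ j / (j.factorial : ℝ) * z ^ j * z ^ n)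
    (f := fun z => Real.exp (-lam * z) * z ^ n)
    (fun j z => |lam| ^ j / (j.factorial : ℝ) * |z| ^ j * |z| ^ n)
    (fun j => by fun_prop)
    (fun j => ae_of_all _ fun z _ => by simp)
    (ae_of_all _ fun z _ => (hasSum_exp_mul _ _).summable.mul_right _)
    (by
      simp_rw [fun z : ℝ => ((hasSum_exp_mul |lam| |z|).mul_right (|z| ^ n)).tsum_eq]
      exact Continuous.intervalIntegrable (by fun_prop) _ _)
    (ae_of_all _ fun z _ => (hasSum_exp_mul _ _).mul_right _)
  convert! h using 2 with j
  simp_rw [mul_assoc, ← pow_add]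
  rw [intervalIntegral.integral_const_mul, integral_pow, zero_pow (by omega), sub_zero]
  congr 2
  · congr 1
    omega
  · push_cast
    ring

theorem continuous_gammaCdf (lam : ℝ) (k : ℕ) : Continuous (gammaCdf lam k) := by
  unfold gammaCdf
  refine continuous_const.mul (intervalIntegral.continuous_primitive (fun a b => ?_) 0)
  exact Continuous.intervalIntegrable (by fun_prop) _ _

theorem integrableOn_pow_mul_exp_mul_halfGaussian (m : ℕ) (lam : ℝ) {t : ℝ} (ht : 0 < t) :
    IntegrableOn (fun y : ℝ => y ^ m * Real.exp (lam * y) *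
      (Real.exp (-(y ^ 2) / (4 * t)) / √(π * t))) (Ioi 0) := by
  have h := ((integrableOn_rpow_mul_exp_neg_mul_sq (b := 1 / (8 * t)) (by positivity)
    (s := m) (lt_of_lt_of_le (by norm_num) m.cast_nonneg)).const_mul
      (Real.exp (2 * t * lam ^ 2) / √(π * t)))
  refine Integrable.mono' h (by fun_prop) ?_
  filter_upwards [ae_restrict_mem measurableSet_Ioi] with y hy
  have hy0 : (0 : ℝ) < y := hy
  rw [Real.norm_of_nonneg (by positivity), Real.rpow_natCast]
  have key : Real.exp (lam * y) * Real.exp (-(y ^ 2) / (4 * t)) ≤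
      Real.exp (2 * t * lam ^ 2) * Real.exp (-(1 / (8 * t)) * y ^ 2) := by
    rw [← Real.exp_add, ← Real.exp_add, Real.exp_le_exp, ← sub_nonneg]
    have : 2 * t * lam ^ 2 + -(1 / (8 * t)) * y ^ 2 - (lam * y + -(y ^ 2) / (4 * t)) =
        (y - 4 * t * lam) ^ 2 / (8 * t) := by
      field_simp
      ring
    rw [this]
    positivity
  calc y ^ m * Real.exp (lam * y) * (Real.exp (-(y ^ 2) / (4 * t)) / √(π * t))
      = y ^ m / √(π * t) * (Real.exp (lam * y) * Real.exp (-(y ^ 2) / (4 * t))) := by ring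
    _ ≤ y ^ m / √(π * t) * (Real.exp (2 * t * lam ^ 2) * Real.exp (-(1 / (8 * t)) * y ^ 2)) := by
      gcongr
    _ = _ := by ring

/-- Dominating series for the power series of the Gamma distribution function. -/
theorem hasSum_gammaCdf_bound (lam : ℝ) (n : ℕ) (y w : ℝ) :
    HasSum (fun j : ℕ => |lam| ^ (n + 1) / (n.factorial : ℝ) *
        (|lam| ^ j / (j.factorial : ℝ) * y ^ j) * (y ^ (n + 1) * w))
      (|lam| ^ (n + 1) / (n.factorial : ℝ) * (y ^ (n + 1) * Real.exp (|lam| * y) * w)) := by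
  convert! ((hasSum_exp_mul |lam| y).mul_left (|lam| ^ (n + 1) / (n.factorial : ℝ))).mul_right
    (y ^ (n + 1) * w) using 1
  ring

theorem norm_gammaCdf_term_le (lam : ℝ) (n j : ℕ) {y w : ℝ} (hy : 0 ≤ y) (hw : 0 ≤ w) :
    ‖lam ^ (n + 1) / (n.factorial : ℝ) *
        ((-lam) ^ j / (j.factorial : ℝ) * (y ^ (n + 1 + j) / ((n + 1 + j : ℕ) : ℝ))) * w‖ ≤
      |lam| ^ (n + 1) / (n.factorial : ℝ) *
        (|lam| ^ j / (j.factorial : ℝ) * y ^ j) * (y ^ (n + 1) * w) := by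
  have hle : y ^ (n + 1 + j) / ((n + 1 + j : ℕ) : ℝ) ≤ y ^ (n + 1 + j) :=
    div_le_self (by positivity) (by exact_mod_cast (by omega : 1 ≤ n + 1 + j))
  have hn : (0 : ℝ) ≤ y ^ (n + 1 + j) / ((n + 1 + j : ℕ) : ℝ) := by positivity
  rw [norm_mul, norm_mul, norm_mul, Real.norm_of_nonneg hw, Real.norm_of_nonneg hn, norm_div,
    norm_div, norm_pow, norm_pow, norm_neg, Real.norm_natCast, Real.norm_natCast,
    Real.norm_eq_abs]
  calc _ ≤ |lam| ^ (n + 1) / (n.factorial : ℝ) *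
        (|lam| ^ j / (j.factorial : ℝ) * y ^ (n + 1 + j)) * w := by gcongr
    _ = _ := by rw [pow_add y]; ring

theorem integrableOn_gammaCdf_mul_halfGaussian (lam : ℝ) (n : ℕ) {t : ℝ} (ht : 0 < t) :
    IntegrableOn (fun y : ℝ => gammaCdf lam (n + 1) y *
      (Real.exp (-(y ^ 2) / (4 * t)) / √(π * t))) (Ioi 0) := by
  refine Integrable.mono' ((integrableOn_pow_mul_exp_mul_halfGaussian (n + 1) |lam| ht).const_mul
    (|lam| ^ (n + 1) / (n.factorial : ℝ)))
    ((continuous_gammaCdf _ _).mul (by fun_prop)).aestronglyMeasurable ?_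
  filter_upwards [ae_restrict_mem measurableSet_Ioi] with y hy
  have hy0 : (0 : ℝ) ≤ y := le_of_lt hy
  set w := Real.exp (-(y ^ 2) / (4 * t)) / √(π * t)
  have hb := hasSum_gammaCdf_bound lam n y w
  rw [← ((hasSum_gammaCdf_succ lam n y).mul_right w).tsum_eq]
  exact tsum_of_norm_bounded hb fun j => norm_gammaCdf_term_le lam n j hy0 (by positivity)

theorem hasSum_integral_gammaCdf_mul_halfGaussian (lam : ℝ) (n : ℕ) {t : ℝ} (ht : 0 < t) :
    HasSum (fun j : ℕ => lam ^ (n + 1) / (n.factorial : ℝ) *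
        ((-lam) ^ j / (j.factorial : ℝ) * (√t ^ (n + 1 + j) * ((n + j).factorial : ℝ) /
          Real.Gamma (((n + 1 + j : ℕ) : ℝ) / 2 + 1))))
      (∫ y in Ioi (0 : ℝ), gammaCdf lam (n + 1) y *
        (Real.exp (-(y ^ 2) / (4 * t)) / √(π * t))) := by
  have h := hasSum_integral_of_dominated_convergence (μ := volume.restrict (Ioi (0 : ℝ)))
    (F := fun (j : ℕ) (y : ℝ) => lam ^ (n + 1) / (n.factorial : ℝ) *
        ((-lam) ^ j / (j.factorial : ℝ) * (y ^ (n + 1 + j) / ((n + 1 + j : ℕ) : ℝ))) *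
        (Real.exp (-(y ^ 2) / (4 * t)) / √(π * t)))
    (f := fun y => gammaCdf lam (n + 1) y * (Real.exp (-(y ^ 2) / (4 * t)) / √(π * t)))
    (fun (j : ℕ) (y : ℝ) => |lam| ^ (n + 1) / (n.factorial : ℝ) *
        (|lam| ^ j / (j.factorial : ℝ) * y ^ j) * (y ^ (n + 1) *
          (Real.exp (-(y ^ 2) / (4 * t)) / √(π * t))))
    (fun j => by fun_prop)
    (fun j => by
      filter_upwards [ae_restrict_mem measurableSet_Ioi] with y hy
      exact norm_gammaCdf_term_le lam n j (le_of_lt hy) (by positivity))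
    (ae_of_all _ fun y => (hasSum_gammaCdf_bound lam n y _).summable)
    (by
      simp_rw [fun y : ℝ => (hasSum_gammaCdf_bound lam n y
        (Real.exp (-(y ^ 2) / (4 * t)) / √(π * t))).tsum_eq]
      exact (integrableOn_pow_mul_exp_mul_halfGaussian (n + 1) |lam| ht).const_mul _)
    (ae_of_all _ fun y => (hasSum_gammaCdf_succ lam n y).mul_right _)
  convert! h using 2 with j
  have hfun : ∀ y : ℝ, lam ^ (n + 1) / (n.factorial : ℝ) *
        ((-lam) ^ j / (j.factorial : ℝ) * (y ^ (n + 1 + j) / ((n + 1 + j : ℕ) : ℝ))) *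
        (Real.exp (-(y ^ 2) / (4 * t)) / √(π * t)) =
      lam ^ (n + 1) / (n.factorial : ℝ) *
        ((-lam) ^ j / (j.factorial : ℝ) / ((n + 1 + j : ℕ) : ℝ)) *
        (y ^ (n + 1 + j) * (Real.exp (-(y ^ 2) / (4 * t)) / √(π * t))) := fun y => by ring
  simp_rw [hfun]
  rw [integral_const_mul, integral_pow_mul_halfGaussian _ ht,
    show (n + 1 + j).factorial = (n + 1 + j) * (n + j).factorial by
      rw [show n + 1 + j = n + j + 1 by omega, Nat.factorial_succ]]
  have hne : ((n + 1 + j : ℕ) : ℝ) ≠ 0 := by positivity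
  rw [Nat.cast_mul]
  field_simp

theorem prod_range_succ_add_eq (n j : ℕ) :
    ∏ i ∈ Finset.range j, (((n + 1 : ℕ) : ℝ) + i) =
      ((n + j).factorial : ℝ) / (n.factorial : ℝ) := by
  rw [eq_div_iff (by positivity), ← Nat.factorial_mul_ascFactorial,
    Nat.ascFactorial_eq_prod_range]
  push_cast
  ring

theorem brownian_gamma_crossing (k : ℕ) (hk : 1 ≤ k) (lam : ℝ) (hlam : 0 < lam) :
    ∀ t > (0:ℝ),
      (∫ y in Set.Ioi (0:ℝ),
          (1 - gammaCdf lam k y) * Real.exp (-(y ^ 2) / (4 * t)) /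
            Real.sqrt (Real.pi * t)) =
        1 - (lam * Real.sqrt t) ^ k *
          gml (1/2) ((k:ℝ)/2 + 1) k (-(lam * Real.sqrt t)) := by
  intro t ht
  obtain ⟨n, rfl⟩ : ∃ n, k = n + 1 := ⟨k - 1, by omega⟩
  have hmass := integral_pow_mul_halfGaussian 0 ht
  have hint := integrableOn_pow_mul_exp_mul_halfGaussian 0 0 ht
  simp only [pow_zero, one_mul, zero_mul, Real.exp_zero, Nat.factorial_zero, Nat.cast_one,
    Nat.cast_zero, zero_div, zero_add, Real.Gamma_one, div_one] at hmass hint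
  simp_rw [mul_div_assoc, sub_mul, one_mul]
  rw [integral_sub hint (integrableOn_gammaCdf_mul_halfGaussian lam n ht), hmass,
    ← (hasSum_integral_gammaCdf_mul_halfGaussian lam n ht).tsum_eq, gml, ← tsum_mul_left]
  congr 2
  funext j
  rw [prod_range_succ_add_eq,
    show (1 / 2 : ℝ) * j + (((n + 1 : ℕ) : ℝ) / 2 + 1) = ((n + 1 + j : ℕ) : ℝ) / 2 + 1 by
      push_cast; ring]
  have hG : Real.Gamma (((n + 1 + j : ℕ) : ℝ) / 2 + 1) ≠ 0 :=
    (Real.Gamma_pos_of_pos (by positivity)).ne'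
  rw [← neg_mul, mul_pow, mul_pow, pow_add √t]
  field_simp
end
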